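/- arXiv:0904.1641 — 2 statements merged into one kernel-verified Lean document; each statement's English description precedes it below -/
import Mathlib

section
/- For every real k with 0 < k < 1, the improper integral ∫_0^1 f(-q^5)^{5-6k} · f(-q)^{6k-1} · q^{-k} dq converges and equals 11^{k-1} · π/sin(kπ) · ₂F₁((1-k)/2, 1 - k/2; 1; -4/121). -/
open MeasureTheory Real

/-- Euler's product `f(-q) = ∏_{n=1}^∞ (1 - qⁿ)`. -/
noncomputable def eulerF (q : ℝ) : ℝ := ∏' n : ℕ, (1 - q ^ (n + 1))

/-- Gauss hypergeometric series `₂F₁(a, b; c; z)`. -/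
noncomputable def hyp2F1 (a b c z : ℝ) : ℝ :=
  ∑' n : ℕ, ((ascPochhammer ℝ n).eval a * (ascPochhammer ℝ n).eval b /
    (ascPochhammer ℝ n).eval c) * z ^ n / n.factorial

namespace LevelFive

section

open Complex Function

local notation "𝕢" => Periodic.qParam

/-- Euler's product in a complex variable. -/
noncomputable def phi (q : ℂ) : ℂ := ∏' n : ℕ, (1 - q ^ (n + 1))

lemma eta_eq (z : ℂ) : ModularForm.eta z = 𝕢 24 z * phi (𝕢 1 z) := rfl

/-- The square of the Dedekind eta function. -/
noncomputable def etaSq (z : ℂ) : ℂ := ModularForm.eta z ^ 2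

lemma etaSq_ne_zero {z : ℂ} (hz : 0 < z.im) : etaSq z ≠ 0 :=
  pow_ne_zero _ (ModularForm.eta_ne_zero hz)

lemma etaSq_neg_inv {z : ℂ} (hz : 0 < z.im) : etaSq (-1 / z) = -I * z * etaSq z := by
  have h := ModularForm.eta_comp_eq_csqrt_I_inv hz
  have hs (w : ℂ) : Complex.sqrt w ^ 2 = w := by
    rw [Complex.sqrt, ← Complex.cpow_nat_mul]
    simp
  simp only [comp_apply, Pi.smul_apply, Pi.mul_apply, smul_eq_mul] at h
  rw [etaSq, h, mul_pow, mul_pow, inv_pow, hs, hs, etaSq, Complex.inv_I, mul_assoc]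

lemma etaSq_eq (z : ℂ) : etaSq z = cexp (2 * π * I * z / 12) * phi (𝕢 1 z) ^ 2 := by
  rw [etaSq, eta_eq, mul_pow, Periodic.qParam, ← Complex.exp_nat_mul]
  congr 2
  push_cast
  ring

lemma etaSq_add_int (z : ℂ) (n : ℤ) :
    etaSq (z + n) = cexp (2 * π * I * n / 12) * etaSq z := by
  have : 𝕢 1 (z + n) = 𝕢 1 z := by
    rw [Periodic.qParam, Periodic.qParam, Complex.exp_eq_exp_iff_exists_int]
    exact ⟨n, by push_cast; ring⟩
  rw [etaSq_eq, etaSq_eq, this, ← mul_assoc, ← Complex.exp_add]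
  ring_nf

lemma exp_mul_div_twelve_ne_zero (n : ℤ) : cexp (2 * π * I * n / 12) ≠ 0 := Complex.exp_ne_zero _

/-- The Hauptmodul `(η(z) / η(5z)) ^ 6` of `Γ₀(5)`. -/
noncomputable def haupt (z : ℂ) : ℂ := etaSq z ^ 3 / etaSq (5 * z) ^ 3

/-- The weight four form `(η(z) η(5z)) ^ 4`. -/
noncomputable def wt (z : ℂ) : ℂ := etaSq z ^ 2 * etaSq (5 * z) ^ 2

lemma five_im {z : ℂ} (hz : 0 < z.im) : 0 < (5 * z).im := by
  simpa using hz

lemma ne_zero_of_im {z : ℂ} (hz : 0 < z.im) : z ≠ 0 := by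
  rintro rfl
  simp at hz

lemma neg_inv_im {z : ℂ} (hz : 0 < z.im) : 0 < (-1 / z).im := by
  have := normSq_pos.2 (ne_zero_of_im hz)
  rw [neg_div, one_div, neg_im, inv_im]
  rw [neg_div, neg_neg]
  positivity

lemma haupt_ne_zero {z : ℂ} (hz : 0 < z.im) : haupt z ≠ 0 :=
  div_ne_zero (pow_ne_zero _ (etaSq_ne_zero hz)) (pow_ne_zero _ (etaSq_ne_zero (five_im hz)))

lemma wt_ne_zero {z : ℂ} (hz : 0 < z.im) : wt z ≠ 0 :=
  mul_ne_zero (pow_ne_zero _ (etaSq_ne_zero hz)) (pow_ne_zero _ (etaSq_ne_zero (five_im hz)))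

lemma exp_five_mul_div_twelve (n : ℤ) :
    cexp (2 * π * I * (5 * n : ℤ) / 12) = cexp (2 * π * I * n / 12) ^ 5 := by
  rw [← Complex.exp_nat_mul]
  push_cast
  ring_nf

lemma exp_pow_twelve (n : ℤ) : cexp (2 * π * I * n / 12) ^ 12 = 1 := by
  rw [← Complex.exp_nat_mul, ← Complex.exp_int_mul_two_pi_mul_I n]
  push_cast
  ring_nf

lemma haupt_add_int (z : ℂ) (n : ℤ) : haupt (z + n) = haupt z := by
  have h : 5 * (z + n) = 5 * z + (5 * n : ℤ) := by push_cast; ring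
  have h1 := exp_pow_twelve n
  have h2 := exp_mul_div_twelve_ne_zero n
  rw [haupt, haupt, h, etaSq_add_int, etaSq_add_int, exp_five_mul_div_twelve]
  rw [mul_pow, mul_pow, ← pow_mul, show 5 * 3 = 3 + 12 by rfl, pow_add, h1, mul_one,
    mul_div_mul_left _ _ (pow_ne_zero _ h2)]

lemma wt_add_int (z : ℂ) (n : ℤ) : wt (z + n) = wt z := by
  have h : 5 * (z + n) = 5 * z + (5 * n : ℤ) := by push_cast; ring
  have h1 := exp_pow_twelve n
  rw [wt, wt, h, etaSq_add_int, etaSq_add_int, exp_five_mul_div_twelve]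
  linear_combination (etaSq z ^ 2 * etaSq (5 * z) ^ 2) * h1

lemma fricke_aux {z : ℂ} (hz : 0 < z.im) : etaSq (-1 / (5 * z)) = -I * (5 * z) * etaSq (5 * z) ∧
    etaSq (5 * (-1 / (5 * z))) = -I * z * etaSq z := by
  refine ⟨etaSq_neg_inv (five_im hz), ?_⟩
  rw [← etaSq_neg_inv hz]
  have := ne_zero_of_im hz
  congr 1
  field_simp

lemma haupt_fricke {z : ℂ} (hz : 0 < z.im) : haupt (-1 / (5 * z)) = 125 / haupt z := by
  obtain ⟨h1, h2⟩ := fricke_aux hz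
  have := ne_zero_of_im hz
  have := etaSq_ne_zero hz
  have := etaSq_ne_zero (five_im hz)
  rw [haupt, haupt, h1, h2]
  field_simp
  norm_num

lemma wt_fricke {z : ℂ} (hz : 0 < z.im) : wt (-1 / (5 * z)) = 25 * z ^ 4 * wt z := by
  obtain ⟨h1, h2⟩ := fricke_aux hz
  rw [wt, wt, h1, h2]
  linear_combination (25 * z ^ 4 * etaSq z ^ 2 * etaSq (5 * z) ^ 2) * I_pow_four

lemma den_ne {z : ℂ} (hz : 0 < z.im) : 5 * z - 2 ≠ 0 := by
  intro h
  have := congrArg Complex.im h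
  simp at this
  exact hz.ne' this

lemma ell_aux {z : ℂ} (hz : 0 < z.im) :
    etaSq ((2 * z - 1) / (5 * z - 2)) = -I * (5 * z - 2) * etaSq z ∧
    etaSq (5 * ((2 * z - 1) / (5 * z - 2))) = -I * (5 * z - 2) * etaSq (5 * z) := by
  have hz0 := ne_zero_of_im hz
  have hd := den_ne hz
  have hd2 : 2 * z - 1 ≠ 0 := by
    intro h
    have := congrArg Complex.im h
    simp at this
    exact hz.ne' this
  have hd' : z * 5 - 2 ≠ 0 := by rwa [mul_comm]
  have hd2' : z * 2 - 1 ≠ 0 := by rwa [mul_comm]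
  have hA : cexp (2 * π * I * (2 : ℤ) / 12) * cexp (2 * π * I * (-2 : ℤ) / 12) = 1 := by
    rw [← Complex.exp_add]
    simp
    ring_nf
    simp
  constructor
  · have hs : 0 < (-1 / (-1 / z + (2 : ℤ))).im := by
      apply neg_inv_im
      simpa using neg_inv_im hz
    have hs' : -1 / (-1 / z + (2 : ℤ)) = -z / (2 * z - 1) := by
      rw [div_eq_div_iff _ hd2]
      · push_cast
        field_simp
        ring
      · intro h
        rw [h] at hs
        simp at hs
    have hss : -1 / (-z / (2 * z - 1)) = -1 / z + (2 : ℤ) := by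
      push_cast
      field_simp
      ring
    rw [hs'] at hs
    have h1 := etaSq_neg_inv hs
    rw [hss, etaSq_add_int, etaSq_neg_inv hz] at h1
    have h2 := etaSq_add_int (-z / (2 * z - 1)) (-2)
    have him : 0 < (-z / (2 * z - 1) + (-2 : ℤ)).im := by simpa using hs
    have h3 := etaSq_neg_inv him
    have h4 : -1 / (-z / (2 * z - 1) + (-2 : ℤ)) = (2 * z - 1) / (5 * z - 2) := by
      have : -z / (2 * z - 1) + (-2 : ℤ) = -(5 * z - 2) / (2 * z - 1) := by
        push_cast
        field_simp
        ring
      rw [this]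
      field_simp
    have h5 : -z / (2 * z - 1) + (-2 : ℤ) = -(5 * z - 2) / (2 * z - 1) := by
      push_cast
      field_simp
      ring
    rw [h4, h2] at h3
    rw [h3, h5]
    generalize etaSq (-z / (2 * z - 1)) = s at *
    generalize cexp (2 * π * I * (2 : ℤ) / 12) = a at *
    generalize cexp (2 * π * I * (-2 : ℤ) / 12) = b at *
    have h6 : s = -(a * (2 * z - 1) * etaSq z) := by
      have : -I * z ≠ 0 := by simp [hz0]
      field_simp at h1
      linear_combination -h1
    rw [h6]
    field_simp
    linear_combination -etaSq z * hA
  · have h1 : 5 * ((2 * z - 1) / (5 * z - 2)) = -1 / (5 * z + (-2 : ℤ)) + (2 : ℤ) := by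
      push_cast
      rw [← sub_eq_add_neg]
      field_simp
      ring
    have him : 0 < (5 * z + (-2 : ℤ)).im := by simpa using hz
    rw [h1, etaSq_add_int, etaSq_neg_inv him, etaSq_add_int]
    push_cast at hA ⊢
    linear_combination -I * (5 * z - 2) * etaSq (5 * z) * hA

lemma haupt_ell {z : ℂ} (hz : 0 < z.im) : haupt ((2 * z - 1) / (5 * z - 2)) = haupt z := by
  obtain ⟨h1, h2⟩ := ell_aux hz
  rw [haupt, haupt, h1, h2, mul_pow, mul_pow _ (etaSq (5 * z)), mul_div_mul_left]
  have := den_ne hz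
  simp [this]

lemma wt_ell {z : ℂ} (hz : 0 < z.im) :
    wt ((2 * z - 1) / (5 * z - 2)) = (5 * z - 2) ^ 4 * wt z := by
  obtain ⟨h1, h2⟩ := ell_aux hz
  rw [wt, wt, h1, h2]
  linear_combination ((5 * z - 2) ^ 4 * etaSq z ^ 2 * etaSq (5 * z) ^ 2) * I_pow_four

lemma haupt_differentiableAt {z : ℂ} (hz : 0 < z.im) : DifferentiableAt ℂ haupt z := by
  have h1 : DifferentiableAt ℂ etaSq z :=
    (ModularForm.differentiableAt_eta_of_mem_upperHalfPlaneSet hz).pow 2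
  have h2 : DifferentiableAt ℂ etaSq (5 * z) :=
    (ModularForm.differentiableAt_eta_of_mem_upperHalfPlaneSet (five_im hz)).pow 2
  have h3 : DifferentiableAt ℂ (fun z => etaSq (5 * z)) z :=
    DifferentiableAt.comp z h2 (by fun_prop)
  exact (h1.pow 3).div (h3.pow 3) (pow_ne_zero _ (etaSq_ne_zero (five_im hz)))

/-- The modular function for `Γ₀(5)` which turns out to be constant. -/
noncomputable def modFun (z : ℂ) : ℂ :=
  (logDeriv haupt z / (2 * π * I)) ^ 2 / wt z - haupt z - 125 / haupt z

lemma modFun_add_int (z : ℂ) (n : ℤ) : modFun (z + n) = modFun z := by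
  have : deriv haupt (z + n) = deriv haupt z := by
    rw [← deriv_comp_add_const]
    simp_rw [haupt_add_int]
  simp only [modFun, logDeriv_apply, haupt_add_int, wt_add_int, this]

lemma upper_mem_nhds {z : ℂ} (hz : 0 < z.im) : ∀ᶠ w in nhds z, 0 < w.im :=
  (isOpen_lt continuous_const Complex.continuous_im).mem_nhds hz

lemma modFun_fricke {z : ℂ} (hz : 0 < z.im) : modFun (-1 / (5 * z)) = modFun z := by
  have hz0 := ne_zero_of_im hz
  have hw : 0 < (-1 / (5 * z)).im := neg_inv_im (five_im hz)
  have hC := haupt_ne_zero hz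
  have hg : HasDerivAt (fun w : ℂ => -1 / (5 * w)) (1 / (5 * z ^ 2)) z := by
    have := (hasDerivAt_inv hz0).const_mul (-1 / 5 : ℂ)
    convert! this using 1
    · ext w
      ring
    · ring
  have h1 := HasDerivAt.comp z (haupt_differentiableAt hw).hasDerivAt hg
  have h2 := ((haupt_differentiableAt hz).hasDerivAt.inv hC).const_mul (125 : ℂ)
  have h3 := h1.congr_of_eventuallyEq (f₁ := fun w => 125 * (haupt w)⁻¹) (by
    filter_upwards [upper_mem_nhds hz] with w hw
    rw [comp_apply, haupt_fricke hw, div_eq_mul_inv])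
  have h4 := h3.unique h2
  have h5 : deriv haupt (-1 / (5 * z)) = -625 * z ^ 2 * deriv haupt z / haupt z ^ 2 := by
    field_simp at h4 ⊢
    linear_combination h4
  have := wt_ne_zero hz
  rw [modFun, modFun, logDeriv_apply, logDeriv_apply, haupt_fricke hz, wt_fricke hz, h5]
  field_simp
  ring

lemma ell_im {z : ℂ} (hz : 0 < z.im) : 0 < ((2 * z - 1) / (5 * z - 2)).im := by
  have hd := den_ne hz
  have hd' : z * 5 - 2 ≠ 0 := by rwa [mul_comm]
  have h1 : (2 * z - 1) / (5 * z - 2) = (-1 / (5 * z + (-2 : ℤ)) + (2 : ℤ)) / (5 : ℝ) := by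
    push_cast
    rw [← sub_eq_add_neg]
    field_simp
    ring
  have h2 := neg_inv_im (z := 5 * z + (-2 : ℤ)) (by simpa using hz)
  rw [h1, Complex.div_ofReal_im, Complex.add_im, Complex.intCast_im, add_zero]
  positivity

lemma modFun_ell {z : ℂ} (hz : 0 < z.im) : modFun ((2 * z - 1) / (5 * z - 2)) = modFun z := by
  have hw := ell_im hz
  have hd := den_ne hz
  have hd' : z * 5 - 2 ≠ 0 := by rwa [mul_comm]
  have hC := haupt_ne_zero hz
  have hg : HasDerivAt (fun w : ℂ => (2 * w - 1) / (5 * w - 2)) (1 / (5 * z - 2) ^ 2) z := by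
    have := (((hasDerivAt_id z).const_mul (2 : ℂ)).sub_const 1).div
      (((hasDerivAt_id z).const_mul (5 : ℂ)).sub_const 2) hd
    convert! this using 1
    simp only [id_eq]
    ring
  have h1 := HasDerivAt.comp z (haupt_differentiableAt hw).hasDerivAt hg
  have h3 := h1.congr_of_eventuallyEq (f₁ := haupt) (by
    filter_upwards [upper_mem_nhds hz] with w hw
    simp [haupt_ell hw])
  have h4 := h3.unique (haupt_differentiableAt hz).hasDerivAt
  have h5 : deriv haupt ((2 * z - 1) / (5 * z - 2)) = (5 * z - 2) ^ 2 * deriv haupt z := by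
    field_simp at h4 ⊢
    linear_combination h4
  have := wt_ne_zero hz
  rw [modFun, modFun, logDeriv_apply, logDeriv_apply, haupt_ell hz, wt_ell hz, h5]
  field_simp


lemma modFun_neg_inv_add_div {z : ℂ} (hz : 0 < z.im) (j : ℤ) :
    modFun ((-1 / z + j) / 5) = modFun z ∨
      ∃ i : ℤ, modFun ((-1 / z + j) / 5) = modFun ((z + i) / 5) := by
  have hz0 := ne_zero_of_im hz
  have him (i : ℤ) : 0 < ((z + i) / 5).im := by
    rw [show ((5 : ℂ)) = (5 : ℝ) by simp, Complex.div_ofReal_im]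
    simpa using hz
  obtain ⟨m, r, hj, hr⟩ : ∃ m r : ℤ, j = 5 * m + r ∧ (r = 0 ∨ r = 1 ∨ r = 2 ∨ r = -1 ∨ r = -2) := by
    have : j % 5 = 0 ∨ j % 5 = 1 ∨ j % 5 = 2 ∨ j % 5 = 3 ∨ j % 5 = 4 := by omega
    rcases this with h | h | h | h | h
    · exact ⟨j / 5, 0, by omega, by simp⟩
    · exact ⟨j / 5, 1, by omega, by simp⟩
    · exact ⟨j / 5, 2, by omega, by simp⟩
    · exact ⟨j / 5 + 1, -2, by omega, by simp⟩
    · exact ⟨j / 5 + 1, -1, by omega, by simp⟩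
  have hred : modFun ((-1 / z + j) / 5) = modFun ((-1 / z + r) / 5) := by
    rw [hj, ← modFun_add_int ((-1 / z + r) / 5) m]
    congr 1
    push_cast
    ring
  rw [hred]
  have hunit (r : ℤ) (hr : (r : ℂ) ^ 2 = 1) :
      modFun ((-1 / z + r) / 5) = modFun ((z + (-r : ℤ)) / 5) := by
    have hu := him (-r)
    have hw : 0 < ((-1 / z + r) / 5).im := by
      rw [show ((5 : ℂ)) = (5 : ℝ) by simp, Complex.div_ofReal_im]
      simpa using neg_inv_im hz
    rw [← modFun_fricke hw, ← modFun_fricke hu,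
      ← modFun_add_int (-1 / (5 * ((z + (-r : ℤ)) / 5))) (-r)]
    have h1 : -1 + z * r ≠ 0 := by
      intro h
      have := ne_zero_of_im hw
      apply this
      field_simp
      linear_combination h
    have h2 : z - r ≠ 0 := by
      intro h
      have := ne_zero_of_im hu
      apply this
      push_cast
      rw [← sub_eq_add_neg, h, zero_div]
    congr 1
    push_cast
    have h3 : -1 / z + r = (-1 + z * r) / z := by field_simp
    have h4 : -1 / (5 * ((-1 + z * r) / z / 5)) = -z / (-1 + z * r) := by field_simp
    have h5 : -1 / (5 * ((z - r) / 5)) + -r = (-1 - r * (z - r)) / (z - r) := by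
      rw [show 5 * ((z - (r : ℂ)) / 5) = z - r by ring, div_add' _ _ _ h2]
      ring
    rw [h3, ← sub_eq_add_neg z, h4, h5, div_eq_div_iff h1 h2]
    linear_combination (1 + z * (z - r)) * hr
  rcases hr with rfl | rfl | rfl | rfl | rfl
  · left
    rw [← modFun_fricke hz]
    congr 1
    push_cast
    field_simp
    ring
  · exact .inr ⟨_, hunit 1 (by norm_num)⟩
  · refine .inr ⟨2, ?_⟩
    rw [← modFun_ell (him 2)]
    congr 1
    push_cast
    rw [show 5 * ((z + 2) / 5) - 2 = z by ring]
    field_simp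
    ring
  · exact .inr ⟨_, hunit (-1) (by norm_num)⟩
  · refine .inr ⟨-2, ?_⟩
    have hu := him (-2)
    have hv : 0 < (-1 / (5 * ((z + (-2 : ℤ)) / 5))).im := neg_inv_im (five_im hu)
    rw [← modFun_fricke hu, ← modFun_ell hv, ← modFun_fricke (ell_im hv)]
    have h2 : z - 2 ≠ 0 := by
      intro h
      have := ne_zero_of_im hu
      apply this
      push_cast
      rw [← sub_eq_add_neg, h, zero_div]
    have h3 : 1 + z * 2 ≠ 0 := by
      intro h
      have := congrArg Complex.im h
      simp at this
      exact hz.ne' this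
    congr 1
    push_cast
    rw [show 5 * ((z + -2) / 5) = z - 2 by ring]
    have h4 : 2 * (-1 / (z - 2)) - 1 = -z / (z - 2) := by
      field_simp
      ring
    have h5 : 5 * (-1 / (z - 2)) - 2 = -(1 + z * 2) / (z - 2) := by
      field_simp
      ring
    rw [h4, h5]
    field_simp
    ring

/-- The values of `modFun` at the six lattices of index five. -/
def modVals (z : ℂ) : Set ℂ :=
  insert (modFun z) (Set.range fun j : ℤ => modFun ((z + j) / 5))

lemma modVals_add_one (z : ℂ) : modVals (z + 1) = modVals z := by
  have h := modFun_add_int z 1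
  rw [Int.cast_one] at h
  rw [modVals, modVals, h]
  congr 1
  rw [← (Equiv.addLeft (1 : ℤ)).surjective.range_comp fun j : ℤ => modFun ((z + j) / 5)]
  congr 1
  ext j
  simp [add_assoc]

lemma modVals_neg_inv_subset {z : ℂ} (hz : 0 < z.im) : modVals (-1 / z) ⊆ modVals z := by
  rintro _ (rfl | ⟨j, rfl⟩)
  · right
    refine ⟨0, ?_⟩
    have him : 0 < (z / 5).im := by
      rw [show ((5 : ℂ)) = (5 : ℝ) by simp, Complex.div_ofReal_im]
      positivity
    have := modFun_fricke him
    simp only [Int.cast_zero, add_zero]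
    rw [← this]
    congr 2
    ring
  · rcases modFun_neg_inv_add_div hz j with h | ⟨i, h⟩
    · exact .inl h
    · exact .inr ⟨i, h.symm⟩

lemma modVals_neg_inv {z : ℂ} (hz : 0 < z.im) : modVals (-1 / z) = modVals z := by
  refine (modVals_neg_inv_subset hz).antisymm ?_
  have := modVals_neg_inv_subset (neg_inv_im hz)
  have h0 := ne_zero_of_im hz
  rwa [show -1 / (-1 / z) = z by field_simp] at this

lemma modVals_smul (g : Matrix.SpecialLinearGroup (Fin 2) ℤ) (τ : UpperHalfPlane) :
    modVals ↑(g • τ) = modVals τ := by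
  have hg : g ∈ Subgroup.closure {ModularGroup.S, ModularGroup.T} := by
    rw [SpecialLinearGroup.SL2Z_generators]
    trivial
  induction hg using Subgroup.closure_induction generalizing τ with
  | mem x hx =>
    rcases hx with rfl | rfl
    · rw [UpperHalfPlane.modular_S_smul, ← modVals_neg_inv τ.2]
      congr 1
      simp [neg_div, inv_neg]
    · rw [UpperHalfPlane.modular_T_smul, ← modVals_add_one τ]
      congr 1
      simp [add_comm]
  | one => simp
  | mul x y _ _ hx hy => rw [mul_smul, hx, hy]
  | inv x _ hx => rw [← hx (x⁻¹ • τ), smul_inv_smul]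

lemma exists_modFun_eq {z : ℂ} (hz : 0 < z.im) :
    ∃ w : ℂ, 1 / 10 ≤ w.im ∧ modFun w = modFun z := by
  obtain ⟨g, hg⟩ := ModularGroup.exists_smul_mem_fd ⟨z, hz⟩
  have h1 := ModularGroup.three_le_four_mul_im_sq_of_mem_fd hg
  have h2 := modVals_smul g ⟨z, hz⟩
  have h3 : modFun z ∈ modVals ↑(g • (⟨z, hz⟩ : UpperHalfPlane)) := by
    rw [h2]
    exact .inl rfl
  generalize g • (⟨z, hz⟩ : UpperHalfPlane) = τ at *
  have h4 : 1 / 2 ≤ (τ : ℂ).im := by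
    have := τ.im_pos
    rw [UpperHalfPlane.coe_im]
    nlinarith
  rcases h3 with h | ⟨j, h⟩
  · exact ⟨τ, by linarith, h.symm⟩
  · refine ⟨_, ?_, h⟩
    rw [show ((5 : ℂ)) = (5 : ℝ) by simp, Complex.div_ofReal_im]
    simp only [Complex.add_im, Complex.intCast_im, add_zero]
    linarith


lemma pow_five_mem_ball {q : ℂ} (hq : ‖q‖ < 1) : ‖q ^ 5‖ < 1 := by
  rw [norm_pow]
  exact pow_lt_one₀ (norm_nonneg _) hq (by norm_num)

lemma phi_ne_zero {q : ℂ} (hq : ‖q‖ < 1) : phi q ≠ 0 := by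
  have h (i : ℕ) : ‖q ^ (i + 1)‖ < 1 := by
    rw [norm_pow]
    exact pow_lt_one₀ (norm_nonneg _) hq (by omega)
  refine tprod_one_add_ne_zero_of_summable (f := fun n ↦ -q ^ (n + 1)) (fun i h0 ↦ ?_) ?_
  · have h1 := h i
    rw [show q ^ (i + 1) = 1 by linear_combination -h0] at h1
    simp at h1
  · simpa using (summable_nat_add_iff 1).mpr (summable_geometric_of_lt_one (norm_nonneg _) hq)

lemma phi_zero : phi 0 = 1 := by simp [phi]

lemma phi_differentiableOn : DifferentiableOn ℂ phi (Metric.ball 0 1) :=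
  ModularForm.differentiableOn_tprod_one_sub_pow

lemma phi_differentiableAt {q : ℂ} (hq : ‖q‖ < 1) : DifferentiableAt ℂ phi q :=
  phi_differentiableOn.differentiableAt (Metric.isOpen_ball.mem_nhds (by simpa using hq))

lemma deriv_phi_differentiableAt {q : ℂ} (hq : ‖q‖ < 1) : DifferentiableAt ℂ (deriv phi) q :=
  (phi_differentiableOn.deriv Metric.isOpen_ball).differentiableAt
    (Metric.isOpen_ball.mem_nhds (by simpa using hq))

lemma logDeriv_phi_zero : logDeriv phi 0 = -1 := by
  have hd (n : ℕ) : logDeriv (fun q : ℂ ↦ 1 - q ^ (n + 1)) 0 = if n = 0 then -1 else 0 := by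
    have : deriv (fun q : ℂ ↦ 1 - q ^ (n + 1)) 0 = -((n + 1) * 0 ^ n) := by
      simp
    rw [logDeriv_apply, this]
    rcases n with _ | n <;> simp
  have h := logDeriv_tprod_eq_tsum (f := fun (n : ℕ) (q : ℂ) ↦ 1 - q ^ (n + 1)) (x := 0)
    Metric.isOpen_ball (by simp) (by simp) (fun _ ↦ by fun_prop)
    (by
      simp_rw [hd]
      exact (hasSum_ite_eq 0 (-1 : ℂ)).summable)
    ModularForm.multipliableLocallyUniformlyOn_one_sub_pow
    (phi_ne_zero (by simp))
  simp_rw [hd, tsum_ite_eq] at h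
  exact h

/-- The logarithmic derivative `q y' / y` of `y = q φ(q⁵)⁶ / φ(q)⁶`. -/
noncomputable def pfun (q : ℂ) : ℂ :=
  1 - 6 * (q * logDeriv phi q) + 30 * (q ^ 5 * logDeriv phi (q ^ 5))

lemma logDeriv_phi_differentiableAt {q : ℂ} (hq : ‖q‖ < 1) :
    DifferentiableAt ℂ (logDeriv phi) q :=
  (deriv_phi_differentiableAt hq).div (phi_differentiableAt hq) (phi_ne_zero hq)

lemma pfun_differentiableAt {q : ℂ} (hq : ‖q‖ < 1) : DifferentiableAt ℂ pfun q := by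
  have h1 := logDeriv_phi_differentiableAt hq
  have h2 : DifferentiableAt ℂ (fun q ↦ logDeriv phi (q ^ 5)) q :=
    DifferentiableAt.comp q (logDeriv_phi_differentiableAt (pow_five_mem_ball hq)) (by fun_prop)
  unfold pfun
  fun_prop

lemma phi_pow_five_differentiableAt {q : ℂ} (hq : ‖q‖ < 1) :
    DifferentiableAt ℂ (fun q ↦ phi (q ^ 5)) q :=
  DifferentiableAt.comp q (phi_differentiableAt (pow_five_mem_ball hq)) (by fun_prop)

/-- The numerator of `modFun` as a function of the nome, up to the term `125 y`. -/
noncomputable def nfun (q : ℂ) : ℂ :=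
  pfun q ^ 2 / (phi q ^ 4 * phi (q ^ 5) ^ 4) - phi q ^ 6 / phi (q ^ 5) ^ 6

lemma nfun_differentiableAt {q : ℂ} (hq : ‖q‖ < 1) : DifferentiableAt ℂ nfun q := by
  have h1 := phi_differentiableAt hq
  have h2 := phi_pow_five_differentiableAt hq
  have h3 := pfun_differentiableAt hq
  have h4 := phi_ne_zero hq
  have h5 := phi_ne_zero (pow_five_mem_ball hq)
  refine DifferentiableAt.sub (.div (by fun_prop) (by fun_prop) ?_)
    (.div (by fun_prop) (by fun_prop) ?_) <;> simp [h4, h5]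

lemma nfun_zero : nfun 0 = 0 := by
  simp [nfun, pfun, phi_zero]

lemma hasDerivAt_phi_zero : HasDerivAt phi (-1) 0 := by
  have h := logDeriv_phi_zero
  rw [logDeriv_apply, phi_zero, div_one] at h
  exact h ▸ (phi_differentiableAt (by simp)).hasDerivAt

lemma deriv_nfun_zero : deriv nfun 0 = 22 := by
  have h1 := hasDerivAt_phi_zero
  have h5 : HasDerivAt (fun q : ℂ ↦ q ^ 5) 0 0 := by simpa using hasDerivAt_pow 5 (0 : ℂ)
  have h2 : HasDerivAt (fun q ↦ phi (q ^ 5)) 0 0 := by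
    have : HasDerivAt phi (-1) ((fun q : ℂ ↦ q ^ 5) 0) := by simpa using h1
    simpa using! this.comp 0 h5
  have h3 : HasDerivAt (logDeriv phi) (deriv (logDeriv phi) 0) 0 :=
    (logDeriv_phi_differentiableAt (by simp)).hasDerivAt
  have h4 : HasDerivAt (fun q ↦ logDeriv phi (q ^ 5)) 0 0 := by
    have : HasDerivAt (logDeriv phi) (deriv (logDeriv phi) 0) ((fun q : ℂ ↦ q ^ 5) 0) := by
      simpa using h3
    simpa using! this.comp 0 h5
  have h6 : HasDerivAt pfun 6 0 := by
    have := (((hasDerivAt_id (0 : ℂ)).mul h3).const_mul 6).const_sub 1 |>.add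
      ((h5.mul h4).const_mul 30)
    convert! this using 1
    simp [logDeriv_phi_zero]
  have h7 := ((h6.pow 2).div ((h1.pow 4).mul (h2.pow 4)) (by simp [phi_zero])).sub
    ((h1.pow 6).div (h2.pow 6) (by simp [phi_zero]))
  have h8 : pfun 0 = 1 := by simp [pfun]
  have h9 : HasDerivAt nfun 22 0 := by
    convert! h7 using 1
    simp [h8, phi_zero]
    norm_num
  exact h9.deriv

/-- `modFun` as a function of the nome, extended to the cusp. -/
noncomputable def hfun (q : ℂ) : ℂ :=
  dslope nfun 0 q - 125 * (q * phi (q ^ 5) ^ 6 / phi q ^ 6)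

lemma hfun_differentiableOn : DifferentiableOn ℂ hfun (Metric.ball 0 1) := by
  refine DifferentiableOn.sub ?_ ?_
  · refine (Complex.differentiableOn_dslope (Metric.ball_mem_nhds _ one_pos)).2 fun q hq ↦ ?_
    exact (nfun_differentiableAt (by simpa using hq)).differentiableWithinAt
  · intro q hq
    have hq : ‖q‖ < 1 := by simpa using hq
    have h1 := phi_differentiableAt hq
    have h2 := phi_pow_five_differentiableAt hq
    have h4 := phi_ne_zero hq
    refine DifferentiableAt.differentiableWithinAt
      (.const_mul (.div (by fun_prop) (by fun_prop) ?_) _)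
    simp [h4]

lemma hfun_zero : hfun 0 = 22 := by
  simp [hfun, deriv_nfun_zero]

lemma hfun_of_ne_zero {q : ℂ} (h0 : q ≠ 0) : hfun q =
    pfun q ^ 2 / (q * phi q ^ 4 * phi (q ^ 5) ^ 4) - phi q ^ 6 / (q * phi (q ^ 5) ^ 6)
      - 125 * (q * phi (q ^ 5) ^ 6 / phi q ^ 6) := by
  rw [hfun, dslope_of_ne _ h0, slope_def_field, nfun_zero, nfun]
  simp only [sub_zero, sub_div, div_div]
  ring_nf

lemma norm_qParam_lt {z : ℂ} (hz : 0 < z.im) : ‖𝕢 1 z‖ < 1 := by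
  rw [Periodic.norm_qParam]
  have := mul_pos Real.pi_pos hz
  simp
  linarith

lemma qParam_five (z : ℂ) : 𝕢 1 (5 * z) = 𝕢 1 z ^ 5 := by
  rw [Periodic.qParam, Periodic.qParam, ← Complex.exp_nat_mul]
  push_cast
  ring_nf

lemma haupt_eq (z : ℂ) :
    haupt z = phi (𝕢 1 z) ^ 6 / (𝕢 1 z * phi (𝕢 1 z ^ 5) ^ 6) := by
  have h1 : cexp (2 * π * I * (5 * z) / 12) ^ 3 = cexp (2 * π * I * z / 12) ^ 3 * 𝕢 1 z := by
    rw [Periodic.qParam, ← Complex.exp_nat_mul, ← Complex.exp_nat_mul, ← Complex.exp_add]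
    push_cast
    ring_nf
  rw [haupt, etaSq_eq, etaSq_eq, qParam_five, mul_pow, mul_pow, h1, mul_assoc _ (𝕢 1 z),
    mul_div_mul_left]
  · ring_nf
  · exact pow_ne_zero _ (Complex.exp_ne_zero _)

lemma wt_eq (z : ℂ) :
    wt z = 𝕢 1 z * phi (𝕢 1 z) ^ 4 * phi (𝕢 1 z ^ 5) ^ 4 := by
  have h1 : cexp (2 * π * I * z / 12) ^ 2 * cexp (2 * π * I * (5 * z) / 12) ^ 2 = 𝕢 1 z := by
    rw [Periodic.qParam, ← Complex.exp_nat_mul, ← Complex.exp_nat_mul, ← Complex.exp_add]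
    push_cast
    ring_nf
  rw [wt, etaSq_eq, etaSq_eq, qParam_five, mul_pow, mul_pow]
  linear_combination (phi (𝕢 1 z) ^ 4 * phi (𝕢 1 z ^ 5) ^ 4) * h1

lemma hasDerivAt_yfun {q : ℂ} (hq : ‖q‖ < 1) :
    HasDerivAt (fun q ↦ q * phi (q ^ 5) ^ 6 / phi q ^ 6)
      (pfun q * (phi (q ^ 5) ^ 6 / phi q ^ 6)) q := by
  have h1 := (phi_differentiableAt hq).hasDerivAt
  have h5 : HasDerivAt (fun q : ℂ ↦ q ^ 5) (5 * q ^ 4) q := by simpa using hasDerivAt_pow 5 q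
  have h2 := ((phi_differentiableAt (pow_five_mem_ball hq)).hasDerivAt).comp q h5
  have h4 := phi_ne_zero hq
  have h4' := phi_ne_zero (pow_five_mem_ball hq)
  convert! ((hasDerivAt_id q).mul (h2.pow 6)).div (h1.pow 6) (pow_ne_zero _ h4) using 1
  simp only [pfun, logDeriv_apply, comp_apply, id]
  simp
  field_simp
  ring

lemma modFun_eq {z : ℂ} (hz : 0 < z.im) : modFun z = hfun (𝕢 1 z) := by
  have hq := norm_qParam_lt hz
  have h0 : 𝕢 1 z ≠ 0 := Complex.exp_ne_zero _
  have h4 := phi_ne_zero hq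
  have h4' := phi_ne_zero (pow_five_mem_ball hq)
  have hd : HasDerivAt (𝕢 1) (2 * π * I * 𝕢 1 z) z := by
    have := ((hasDerivAt_id z).const_mul (2 * π * I)).cexp
    convert! this using 1
    · ext; simp [Periodic.qParam]
    · simp [Periodic.qParam]; ring
  have h := ((hasDerivAt_yfun hq).comp z hd).inv (by simp [h0, h4, h4'])
  have he : haupt = ((fun q ↦ q * phi (q ^ 5) ^ 6 / phi q ^ 6) ∘ 𝕢 1)⁻¹ := by
    ext w
    simp [haupt_eq]
  rw [← he] at h
  have hl : logDeriv haupt z / (2 * π * I) = -pfun (𝕢 1 z) := by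
    have := Real.pi_ne_zero
    have hI := Complex.I_ne_zero
    rw [logDeriv_apply, h.deriv, haupt_eq]
    simp only [comp_apply]
    field_simp
  rw [modFun, hl, haupt_eq, wt_eq, hfun_of_ne_zero h0]
  simp only [neg_sq]
  congr 1
  field_simp

lemma hfun_eq {q : ℂ} (hq : ‖q‖ < 1) : hfun q = 22 := by
  set r : ℝ := Real.exp (-2 * π * (1 / 10) / 1) with hr
  have hr1 : r < 1 := by
    rw [hr, Real.exp_lt_one_iff]
    have := Real.pi_pos
    linarith
  have hr0 : 0 < r := Real.exp_pos _
  have hsub : Metric.closedBall (0 : ℂ) r ⊆ Metric.ball 0 1 := Metric.closedBall_subset_ball hr1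
  obtain ⟨c, hc, hmax⟩ := (isCompact_closedBall (0 : ℂ) r).exists_isMaxOn
    ⟨0, by simp [hr0.le]⟩ (hfun_differentiableOn.continuousOn.mono hsub).norm
  have hmax' : IsMaxOn (norm ∘ hfun) (Metric.ball 0 1) c := by
    intro w hw
    have hw : ‖w‖ < 1 := by simpa using hw
    obtain rfl | h0 := eq_or_ne w 0
    · exact hmax (by simp [hr0.le])
    have him := Periodic.im_invQParam_pos_of_norm_lt_one one_pos hw h0
    obtain ⟨v, hv, hv'⟩ := exists_modFun_eq him
    rw [modFun_eq him, modFun_eq (by linarith), Periodic.qParam_right_inv one_ne_zero h0] at hv'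
    have : 𝕢 1 v ∈ Metric.closedBall (0 : ℂ) r := by
      simp only [Metric.mem_closedBall, dist_zero_right, Periodic.norm_qParam, hr]
      have := Real.pi_pos
      gcongr _root_.Real.exp (?_ / _)
      nlinarith
    have := hmax this
    simpa [hv'] using this
  have heq := Complex.eqOn_of_isPreconnected_of_isMaxOn_norm
    (convex_ball (0 : ℂ) 1).isPreconnected Metric.isOpen_ball hfun_differentiableOn (hsub hc) hmax'
  have h1 := heq (show q ∈ Metric.ball (0 : ℂ) 1 by simpa using hq)
  have h2 := heq (show (0 : ℂ) ∈ Metric.ball (0 : ℂ) 1 by simp)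
  rw [h1, ← hfun_zero, h2]
  rfl

lemma pfun_sq {q : ℂ} (hq : ‖q‖ < 1) (h0 : q ≠ 0) :
    pfun q ^ 2 * phi (q ^ 5) ^ 2 * phi q ^ 2 =
      phi q ^ 12 + 22 * q * phi (q ^ 5) ^ 6 * phi q ^ 6 + 125 * q ^ 2 * phi (q ^ 5) ^ 12 := by
  have h4 := phi_ne_zero hq
  have h4' := phi_ne_zero (pow_five_mem_ball hq)
  have h := hfun_eq hq
  rw [hfun_of_ne_zero h0] at h
  field_simp at h
  linear_combination h

end

lemma multipliable_one_sub_pow {q : ℝ} (hq0 : 0 ≤ q) (hq : q < 1) :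
    Multipliable fun n : ℕ ↦ 1 - q ^ (n + 1) := by
  simp_rw [sub_eq_add_neg]
  refine multipliable_one_add_of_summable ?_
  simpa [abs_of_nonneg hq0] using
    (summable_nat_add_iff 1).mpr (summable_geometric_of_lt_one hq0 hq)

lemma phi_ofReal {q : ℝ} (hq0 : 0 ≤ q) (hq : q < 1) : phi q = (eulerF q : ℂ) := by
  have := (multipliable_one_sub_pow hq0 hq).map_tprod Complex.ofRealHom Complex.continuous_ofReal
  simp only [Complex.ofRealHom_eq_coe] at this
  rw [eulerF, this, phi]
  push_cast
  rfl

lemma norm_ofReal_lt {q : ℝ} (hq0 : 0 ≤ q) (hq : q < 1) : ‖(q : ℂ)‖ < 1 := by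
  simpa [abs_of_nonneg hq0]

lemma pow_five_lt {q : ℝ} (hq0 : 0 ≤ q) (hq : q < 1) : q ^ 5 < 1 :=
  pow_lt_one₀ hq0 hq (by norm_num)

lemma phi_ofReal_pow_five {q : ℝ} (hq0 : 0 ≤ q) (hq : q < 1) :
    phi ((q : ℂ) ^ 5) = (eulerF (q ^ 5) : ℂ) := by
  rw [← phi_ofReal (by positivity) (pow_five_lt hq0 hq)]
  push_cast
  rfl

lemma eulerF_pos {q : ℝ} (hq0 : 0 ≤ q) (hq : q < 1) : 0 < eulerF q := by
  refine lt_of_le_of_ne ?_ fun h ↦ phi_ne_zero (norm_ofReal_lt hq0 hq) ?_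
  · refine ge_of_tendsto' (multipliable_one_sub_pow hq0 hq).tendsto_prod_tprod_nat fun n ↦ ?_
    exact Finset.prod_nonneg fun i _ ↦ sub_nonneg.2 (pow_le_one₀ hq0 hq.le)
  · rw [phi_ofReal hq0 hq, ← h, Complex.ofReal_zero]

lemma prod_one_sub_pow_le {q : ℝ} (hq0 : 0 ≤ q) (hq : q < 1) (N : ℕ) :
    ∏ n ∈ Finset.range (5 * (N + 1)), (1 - q ^ (n + 1)) ≤
      (1 - q) * ∏ n ∈ Finset.range (N + 1), (1 - (q ^ 5) ^ (n + 1)) := by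
  have h0 (n : ℕ) : 0 ≤ 1 - q ^ n := sub_nonneg.2 (pow_le_one₀ hq0 hq.le)
  have h1 (n : ℕ) : 1 - q ^ n ≤ 1 := by linarith [pow_nonneg hq0 n]
  have hm (a b : ℕ) : (1 - q ^ a) * (1 - q ^ b) ≤ 1 := mul_le_one₀ (h1 _) (h0 _) (h1 _)
  have hm' (a b : ℕ) : 0 ≤ (1 - q ^ a) * (1 - q ^ b) := mul_nonneg (h0 _) (h0 _)
  induction N with
  | zero =>
    have h3 : (1 - q ^ 2) * (1 - q ^ 3) * (1 - q ^ 4) ≤ 1 := mul_le_one₀ (hm 2 3) (h0 4) (h1 4)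
    have h4 : 0 ≤ (1 - q) * (1 - q ^ 5) := by simpa using hm' 1 5
    calc _ = (1 - q) * (1 - q ^ 5) * ((1 - q ^ 2) * (1 - q ^ 3) * (1 - q ^ 4)) := by
          simp [Finset.prod_range_succ]; ring
      _ ≤ (1 - q) * (1 - q ^ 5) * 1 := by gcongr
      _ = _ := by simp
  | succ N ih =>
    rw [Finset.prod_range_succ _ (N + 1), show 5 * (N + 1 + 1) = 5 * (N + 1) + 4 + 1 by ring,
      Finset.prod_range_succ, Finset.prod_range_add, ← mul_assoc,
      show 5 * (N + 1) + 4 + 1 = 5 * (N + 1 + 1) by ring, pow_mul]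
    have hle : ∏ x ∈ Finset.range 4, (1 - q ^ (5 * (N + 1) + x + 1)) ≤ 1 :=
      Finset.prod_le_one (fun _ _ ↦ h0 _) fun _ _ ↦ h1 _
    have hnn : 0 ≤ ∏ n ∈ Finset.range (5 * (N + 1)), (1 - q ^ (n + 1)) :=
      Finset.prod_nonneg fun _ _ ↦ h0 _
    have := h0 (5 * (N + 1 + 1))
    rw [pow_mul] at this
    exact mul_le_mul_of_nonneg_right ((mul_le_of_le_one_right hnn hle).trans ih) this

lemma eulerF_le {q : ℝ} (hq0 : 0 ≤ q) (hq : q < 1) :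
    eulerF q ≤ (1 - q) * eulerF (q ^ 5) := by
  have h1 := (multipliable_one_sub_pow hq0 hq).tendsto_prod_tprod_nat
  have h2 := (multipliable_one_sub_pow (by positivity) (pow_five_lt hq0 hq)).tendsto_prod_tprod_nat
  have ht : Filter.Tendsto (fun N : ℕ ↦ N + 1) Filter.atTop Filter.atTop :=
    Filter.tendsto_add_atTop_nat 1
  have h5 : Filter.Tendsto (fun N : ℕ ↦ 5 * (N + 1)) Filter.atTop Filter.atTop :=
    ht.const_mul_atTop' (by norm_num)
  exact le_of_tendsto_of_tendsto' (h1.comp h5) ((h2.comp ht).const_mul (1 - q))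
    fun N ↦ prod_one_sub_pow_le hq0 hq N

/-- The reciprocal `q (f(-q⁵) / f(-q))⁶` of the Hauptmodul, on the real axis. -/
noncomputable def yfun (q : ℝ) : ℝ := q * eulerF (q ^ 5) ^ 6 / eulerF q ^ 6

lemma hasDerivAt_yfun_real {q : ℝ} (hq0 : 0 < q) (hq : q < 1) :
    HasDerivAt yfun ((pfun q).re * (eulerF (q ^ 5) ^ 6 / eulerF q ^ 6)) q := by
  have h := (hasDerivAt_yfun (norm_ofReal_lt hq0.le hq)).real_of_complex
  rw [phi_ofReal_pow_five hq0.le hq, phi_ofReal hq0.le hq] at h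
  norm_cast at h
  rw [Complex.re_mul_ofReal] at h
  refine h.congr_of_eventuallyEq ?_
  filter_upwards [Ioo_mem_nhds hq0 hq] with x hx
  rw [phi_ofReal (pow_pos hx.1 5).le (pow_five_lt hx.1.le hx.2), phi_ofReal hx.1.le hx.2, yfun]
  norm_cast

lemma pfun_sq_ofReal {q : ℝ} (hq0 : 0 < q) (hq : q < 1) :
    0 < (pfun q).re ^ 2 ∧ (pfun q).re ^ 2 * eulerF (q ^ 5) ^ 2 * eulerF q ^ 2 =
      eulerF q ^ 12 + 22 * q * eulerF (q ^ 5) ^ 6 * eulerF q ^ 6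
        + 125 * q ^ 2 * eulerF (q ^ 5) ^ 12 := by
  have h1 := eulerF_pos hq0.le hq
  have h5 := eulerF_pos (pow_pos hq0 5).le (pow_five_lt hq0.le hq)
  have h := pfun_sq (norm_ofReal_lt hq0.le hq) (by simpa using hq0.ne')
  rw [phi_ofReal_pow_five hq0.le hq, phi_ofReal hq0.le hq] at h
  norm_cast at h
  rw [mul_assoc] at h
  norm_cast at h
  set R := eulerF q ^ 12 + 22 * q * eulerF (q ^ 5) ^ 6 * eulerF q ^ 6
        + 125 * q ^ 2 * eulerF (q ^ 5) ^ 12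
  have hR : 0 < R := by positivity
  have hD : 0 < eulerF (q ^ 5) ^ 2 * eulerF q ^ 2 := by positivity
  have hre := congrArg Complex.re h
  have him := congrArg Complex.im h
  rw [Complex.re_mul_ofReal, Complex.ofReal_re, sq, Complex.mul_re] at hre
  rw [Complex.im_mul_ofReal, Complex.ofReal_im, sq, Complex.mul_im, mul_eq_zero_iff_right hD.ne']
    at him
  have hpos : 0 < (pfun q).re * (pfun q).re - (pfun q).im * (pfun q).im := by
    refine pos_of_mul_pos_left (hre ▸ hR) hD.le
  have hi : (pfun q).im = 0 := by
    have : (pfun q).re * (pfun q).im = 0 := by linarith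
    rcases mul_eq_zero.1 this with h0 | h0
    · rw [h0] at hpos
      nlinarith [sq_nonneg (pfun q).im]
    · exact h0
  rw [hi] at hpos hre
  refine ⟨by nlinarith, by linarith⟩

lemma pfun_re_pos {q : ℝ} (hq0 : 0 < q) (hq : q < 1) : 0 < (pfun q).re := by
  have hc : ContinuousOn (fun x : ℝ ↦ (pfun x).re) (Set.Icc 0 q) := by
    intro x hx
    have hx1 : x < 1 := hx.2.trans_lt hq
    have := (pfun_differentiableAt (norm_ofReal_lt hx.1 hx1)).continuousAt
    have h2 : ContinuousAt (fun x : ℝ ↦ pfun x) x :=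
      ContinuousAt.comp (f := fun x : ℝ ↦ (x : ℂ)) this Complex.continuous_ofReal.continuousAt
    exact (Complex.continuous_re.continuousAt.comp h2).continuousWithinAt
  by_contra! hneg
  have h0 : (pfun (0 : ℝ)).re = 1 := by simp [pfun]
  obtain ⟨x, hx, hx0⟩ := intermediate_value_Icc' hq0.le hc
    (show (0 : ℝ) ∈ _ from ⟨hneg, h0 ▸ zero_le_one⟩)
  simp only at hx0
  obtain rfl | hx' := hx.1.eq_or_lt
  · rw [h0] at hx0
    norm_num at hx0
  · have := (pfun_sq_ofReal hx' (hx.2.trans_lt hq)).1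
    rw [hx0] at this
    norm_num at this

lemma exists_yfun_eq {t : ℝ} (ht : 0 < t) : ∃ q ∈ Set.Ioo (0 : ℝ) 1, yfun q = t := by
  set ε := min (1 / 2) (1 / (2 * t)) with hε
  have hε0 : 0 < ε := by positivity
  have hε1 : ε ≤ 1 / 2 := min_le_left _ _
  have hε2 : ε ≤ 1 / (2 * t) := min_le_right _ _
  have hq0 : 0 < 1 - ε := by linarith
  have hq1 : 1 - ε < 1 := by linarith
  have hy : t ≤ yfun (1 - ε) := by
    have h1 := eulerF_pos hq0.le hq1
    have h := eulerF_le hq0.le hq1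
    rw [sub_sub_cancel] at h
    have h2 : eulerF (1 - ε) ^ 6 ≤ ε ^ 6 * eulerF ((1 - ε) ^ 5) ^ 6 := by
      rw [← mul_pow]
      gcongr
    have h3 : t * ε ≤ 1 / 2 := by
      calc t * ε ≤ t * (1 / (2 * t)) := by gcongr
        _ = 1 / 2 := by field_simp
    have h4 : ε ^ 6 ≤ ε := pow_le_of_le_one hε0.le (by linarith) (by norm_num)
    rw [yfun, le_div_iff₀ (by positivity)]
    calc t * eulerF (1 - ε) ^ 6 ≤ t * (ε ^ 6 * eulerF ((1 - ε) ^ 5) ^ 6) := by gcongr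
      _ ≤ t * (ε * eulerF ((1 - ε) ^ 5) ^ 6) := by gcongr
      _ = (t * ε) * eulerF ((1 - ε) ^ 5) ^ 6 := by ring
      _ ≤ (1 - ε) * eulerF ((1 - ε) ^ 5) ^ 6 := by gcongr; linarith
  have hc : ContinuousOn yfun (Set.Icc 0 (1 - ε)) := by
    have he : ContinuousOn eulerF (Set.Ico 0 1) := by
      have : ContinuousOn (fun x : ℝ ↦ (phi x).re) (Set.Ico 0 1) := by
        intro x hx
        have h2 : ContinuousAt (fun x : ℝ ↦ phi x) x :=
          ContinuousAt.comp (f := fun x : ℝ ↦ (x : ℂ))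
            (phi_differentiableAt (norm_ofReal_lt hx.1 hx.2)).continuousAt
            Complex.continuous_ofReal.continuousAt
        exact (Complex.continuous_re.continuousAt.comp h2).continuousWithinAt
      exact this.congr fun x hx ↦ by simp [phi_ofReal hx.1 hx.2]
    have hmem (x : ℝ) (hx : x ∈ Set.Icc 0 (1 - ε)) : x ∈ Set.Ico (0 : ℝ) 1 :=
      ⟨hx.1, hx.2.trans_lt hq1⟩
    have he5 : ContinuousOn (fun x ↦ eulerF (x ^ 5)) (Set.Icc 0 (1 - ε)) :=
      he.comp (by fun_prop) fun x hx ↦ ⟨pow_nonneg hx.1 5, pow_five_lt hx.1 (hmem x hx).2⟩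
    exact (continuousOn_id.mul (he5.pow 6)).div ((he.mono hmem).pow 6) fun x hx ↦
      pow_ne_zero _ (eulerF_pos hx.1 (hmem x hx).2).ne'
  have h0 : yfun 0 = 0 := by simp [yfun]
  obtain ⟨q, hq, rfl⟩ := intermediate_value_Icc hq0.le hc ⟨h0.le.trans ht.le, hy⟩
  refine ⟨q, ⟨lt_of_le_of_ne hq.1 ?_, hq.2.trans_lt hq1⟩, rfl⟩
  rintro rfl
  exact ht.ne' h0

lemma yfun_pos {q : ℝ} (hq0 : 0 < q) (hq : q < 1) : 0 < yfun q := by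
  have h1 := eulerF_pos hq0.le hq
  have h5 := eulerF_pos (pow_pos hq0 5).le (pow_five_lt hq0.le hq)
  unfold yfun
  positivity

lemma yfun_strictMonoOn : StrictMonoOn yfun (Set.Ioo 0 1) := by
  refine strictMonoOn_of_deriv_pos (convex_Ioo 0 1)
    (fun q hq ↦ (hasDerivAt_yfun_real hq.1 hq.2).continuousAt.continuousWithinAt) ?_
  rw [interior_Ioo]
  intro q hq
  have h1 := eulerF_pos hq.1.le hq.2
  have h5 := eulerF_pos (pow_pos hq.1 5).le (pow_five_lt hq.1.le hq.2)
  have := pfun_re_pos hq.1 hq.2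
  rw [(hasDerivAt_yfun_real hq.1 hq.2).deriv]
  positivity

/-- The change of variables carrying the nome to the algebraic integral. -/
noncomputable def sfun (q : ℝ) : ℝ := 11 * yfun q / (1 + 11 * yfun q)

lemma hasDerivAt_sfun {q : ℝ} (hq0 : 0 < q) (hq : q < 1) :
    HasDerivAt sfun (11 * ((pfun q).re * (eulerF (q ^ 5) ^ 6 / eulerF q ^ 6)) /
      (1 + 11 * yfun q) ^ 2) q := by
  have hy := yfun_pos hq0 hq
  have h := (hasDerivAt_yfun_real hq0 hq).const_mul 11
  convert! h.div (h.const_add 1) (by positivity) using 1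
  ring

lemma sfun_injOn : Set.InjOn sfun (Set.Ioo 0 1) := by
  intro a ha b hb hab
  have h1 := yfun_pos ha.1 ha.2
  have h2 := yfun_pos hb.1 hb.2
  refine yfun_strictMonoOn.injOn ha hb ?_
  rw [sfun, sfun, div_eq_div_iff (by positivity) (by positivity)] at hab
  linarith

lemma sfun_image : sfun '' Set.Ioo 0 1 = Set.Ioo 0 1 := by
  ext t
  constructor
  · rintro ⟨q, hq, rfl⟩
    have := yfun_pos hq.1 hq.2
    refine ⟨by unfold sfun; positivity, ?_⟩
    rw [sfun, div_lt_one (by positivity)]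
    linarith
  · intro ht
    have h1 : 0 < 1 - t := sub_pos.2 ht.2
    obtain ⟨q, hq, h⟩ := exists_yfun_eq (t := t / (11 * (1 - t)))
      (div_pos ht.1 (by positivity))
    refine ⟨q, hq, ?_⟩
    rw [sfun, h]
    field_simp
    ring

lemma integrand_eq (k : ℝ) {q : ℝ} (hq0 : 0 < q) (hq : q < 1) :
    eulerF (q ^ 5) ^ (5 - 6 * k) * eulerF q ^ (6 * k - 1) * q ^ (-k) =
      11 ^ (k - 1) * (|11 * ((pfun q).re * (eulerF (q ^ 5) ^ 6 / eulerF q ^ 6)) /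
      (1 + 11 * yfun q) ^ 2| • ((1 - sfun q) ^ (k - 1) * sfun q ^ (-k) *
        (1 + 4 * sfun q ^ 2 / 121) ^ (-1 / 2 : ℝ))) := by
  have h1 := eulerF_pos hq0.le hq
  have h5 := eulerF_pos (pow_pos hq0 5).le (pow_five_lt hq0.le hq)
  have hP := pfun_re_pos hq0 hq
  have hy := yfun_pos hq0 hq
  have hsq := (pfun_sq_ofReal hq0 hq).2
  have hyd : yfun q = q * eulerF (q ^ 5) ^ 6 / eulerF q ^ 6 := rfl
  have hs1 : 1 - sfun q = (1 + 11 * yfun q)⁻¹ := by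
    rw [sfun]
    field_simp
    ring
  have hs : sfun q = 11 * yfun q * (1 + 11 * yfun q)⁻¹ := rfl
  have hroot : (1 + 4 * sfun q ^ 2 / 121) ^ (-1 / 2 : ℝ) =
      (1 + 11 * yfun q) * eulerF q ^ 5 / ((pfun q).re * eulerF (q ^ 5)) := by
    have : 1 + 4 * sfun q ^ 2 / 121 =
        (((1 + 11 * yfun q) * eulerF q ^ 5 / ((pfun q).re * eulerF (q ^ 5))) ^ 2)⁻¹ := by
      rw [hs, ← inv_pow, inv_div, div_pow, mul_pow (pfun q).re]
      have hsq' : (pfun q).re ^ 2 * eulerF (q ^ 5) ^ 2 =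
          eulerF q ^ 10 * (1 + 22 * yfun q + 125 * yfun q ^ 2) := by
        rw [hyd]
        field_simp
        linear_combination hsq
      rw [hsq']
      field_simp
      ring
    rw [this, neg_div, Real.rpow_neg (by positivity), ← Real.inv_rpow (by positivity), inv_inv,
      ← Real.sqrt_eq_rpow, Real.sqrt_sq (by positivity)]
  rw [hroot, hs1, hs, abs_of_pos (by positivity), smul_eq_mul]
  set Y := yfun q
  set a := eulerF q
  set b := eulerF (q ^ 5)
  have hpow (x : ℝ) (n : ℕ) (hx : 0 < x) : (x ^ n) ^ k = (x ^ k) ^ n := by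
    rw [← Real.rpow_natCast_mul hx.le, mul_comm, Real.rpow_mul_natCast hx.le]
  rw [Real.inv_rpow (by positivity), Real.mul_rpow (by positivity) (by positivity),
    Real.inv_rpow (by positivity), Real.rpow_neg (by positivity), Real.rpow_neg (by positivity),
    Real.rpow_neg (by positivity), Real.mul_rpow (by positivity) (by positivity)]
  simp only [Real.rpow_sub h1, Real.rpow_sub h5, Real.rpow_sub (show 0 < 1 + 11 * Y by positivity),
    Real.rpow_sub (show (0 : ℝ) < 11 by norm_num), Real.rpow_one]
  have hYk : Y ^ k = q ^ k * (b ^ k) ^ 6 / (a ^ k) ^ 6 := by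
    rw [hyd, Real.div_rpow (by positivity) (by positivity), Real.mul_rpow (by positivity)
      (by positivity), hpow _ _ h1, hpow _ _ h5]
  have h6 (x : ℝ) (hx : 0 < x) : x ^ (6 * k) = (x ^ k) ^ 6 := by
    rw [mul_comm, ← Real.rpow_mul_natCast hx.le]
    norm_num
  have hb5 : b ^ (5 : ℝ) = b ^ 5 := by exact_mod_cast Real.rpow_natCast b 5
  rw [h6 a h1, h6 b h5, hYk, hb5]
  have e1 : 0 < a ^ k := by positivity
  have e2 : 0 < b ^ k := by positivity
  have e3 : 0 < q ^ k := by positivity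
  have e4 : 0 < (11 : ℝ) ^ k := by positivity
  have e5 : 0 < (1 + 11 * Y) ^ k := by positivity
  have e6 : 0 < 1 + 11 * Y := by positivity
  field_simp

lemma real_betaIntegral {a b : ℝ} (ha : 0 < a) (hb : 0 < b) :
    IntegrableOn (fun x : ℝ ↦ x ^ (a - 1) * (1 - x) ^ (b - 1)) (Set.Ioo 0 1) ∧
      ∫ x in Set.Ioo (0 : ℝ) 1, x ^ (a - 1) * (1 - x) ^ (b - 1) =
        Real.Gamma a * Real.Gamma b / Real.Gamma (a + b) := by
  have hc := Complex.betaIntegral_convergent (u := a) (v := b) (by simpa) (by simpa)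
  rw [intervalIntegrable_iff_integrableOn_Ioo_of_le zero_le_one] at hc
  have hre : Set.EqOn (fun x : ℝ ↦ ((x : ℂ) ^ ((a : ℂ) - 1) * (1 - (x : ℂ)) ^ ((b : ℂ) - 1)).re)
      (fun x : ℝ ↦ x ^ (a - 1) * (1 - x) ^ (b - 1)) (Set.Ioo 0 1) := by
    intro x hx
    have h1 : 0 ≤ 1 - x := by linarith [hx.2]
    simp only
    rw [← Complex.ofReal_one, ← Complex.ofReal_sub, ← Complex.ofReal_sub, ← Complex.ofReal_sub,
      ← Complex.ofReal_cpow hx.1.le, ← Complex.ofReal_cpow h1, ← Complex.ofReal_mul,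
      Complex.ofReal_re]
  refine ⟨IntegrableOn.congr_fun hc.re hre measurableSet_Ioo, ?_⟩
  change _ = ProbabilityTheory.beta a b
  rw [ProbabilityTheory.beta_eq_betaIntegralReal a b ha hb, Complex.betaIntegral,
    intervalIntegral.integral_of_le zero_le_one, integral_Ioc_eq_integral_Ioo,
    ← setIntegral_congr_fun measurableSet_Ioo hre]
  exact integral_re hc

lemma hasSum_rpow_neg_half {x : ℝ} (hx : |x| < 1) :
    HasSum (fun n : ℕ ↦ (ascPochhammer ℝ n).eval (1 / 2) / n.factorial * x ^ n)
      ((1 - x) ^ (-1 / 2 : ℝ)) := by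
  have h := (Real.one_div_one_sub_rpow_hasFPowerSeriesOnBall_zero (1 / 2)).hasSum (y := x)
    (by simpa [Real.enorm_eq_ofReal_abs] using hx)
  have hc (n : ℕ) : Ring.choose ((1 / 2 : ℝ) + n - 1) n =
      (ascPochhammer ℝ n).eval (1 / 2) / n.factorial := by
    have h1 := Ring.factorial_nsmul_multichoose_eq_ascPochhammer (1 / 2 : ℝ) n
    rw [Polynomial.ascPochhammer_smeval_eq_eval, nsmul_eq_mul] at h1
    rw [← h1, mul_div_cancel_left₀ _ (by positivity), Ring.choose]
    congr 1
    ring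
  have h2 : 1 / (1 - (0 + x)) ^ (1 / 2 : ℝ) = (1 - x) ^ (-1 / 2 : ℝ) := by
    rw [zero_add, neg_div, Real.rpow_neg (by linarith [(abs_lt.1 hx).2]), one_div]
  rw [h2] at h
  refine h.congr_fun fun n ↦ ?_
  rw [← hc n]
  simp [mul_comm]

lemma ascPochhammer_half_le (n : ℕ) : (ascPochhammer ℝ n).eval (1 / 2) ≤ n.factorial := by
  induction n with
  | zero => simp
  | succ n ih =>
    rw [ascPochhammer_succ_eval, Nat.factorial_succ, mul_comm (n + 1)]
    push_cast
    rw [add_comm (n : ℝ)]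
    gcongr
    norm_num

lemma Gamma_ratio {k : ℝ} (hk : k < 1) (n : ℕ) :
    Real.Gamma (2 * n + 1 - k) / Real.Gamma (2 * n + 1) = Real.Gamma (1 - k) *
      ((ascPochhammer ℝ n).eval ((1 - k) / 2) * (ascPochhammer ℝ n).eval (1 - k / 2) /
        (n.factorial * (ascPochhammer ℝ n).eval (1 / 2))) := by
  induction n with
  | zero => simp
  | succ n ih =>
    have h1 : (0 : ℝ) < 2 * n + 1 - k := by linarith [n.cast_nonneg (α := ℝ)]
    have e1 : Real.Gamma (2 * (n + 1 : ℕ) + 1 - k) =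
        (2 * n + 2 - k) * ((2 * n + 1 - k) * Real.Gamma (2 * n + 1 - k)) := by
      rw [← Real.Gamma_add_one h1.ne', show 2 * n + 2 - k = 2 * n + 1 - k + 1 by ring,
        ← Real.Gamma_add_one (by linarith)]
      push_cast; ring_nf
    have e2 : Real.Gamma (2 * (n + 1 : ℕ) + 1) =
        (2 * n + 2) * ((2 * n + 1) * Real.Gamma (2 * n + 1)) := by
      rw [← Real.Gamma_add_one (by positivity), show (2 * n + 2 : ℝ) = 2 * n + 1 + 1 by ring,
        ← Real.Gamma_add_one (by positivity)]
      push_cast; ring_nf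
    have h3 := ascPochhammer_pos n (1 / 2 : ℝ) (by norm_num)
    have h4 : 0 < Real.Gamma (2 * n + 1) := Real.Gamma_pos_of_pos (by positivity)
    rw [div_eq_iff h4.ne'] at ih
    rw [e1, e2, ih]
    simp only [ascPochhammer_succ_eval, Nat.factorial_succ]
    push_cast
    field_simp
    ring

lemma algebraic_integral {k : ℝ} (hk0 : 0 < k) (hk1 : k < 1) :
    IntegrableOn (fun s : ℝ ↦ (1 - s) ^ (k - 1) * s ^ (-k) *
        (1 + 4 * s ^ 2 / 121) ^ (-1 / 2 : ℝ)) (Set.Ioo 0 1) ∧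
      ∫ s in Set.Ioo (0 : ℝ) 1, (1 - s) ^ (k - 1) * s ^ (-k) *
        (1 + 4 * s ^ 2 / 121) ^ (-1 / 2 : ℝ) =
        π / Real.sin (k * π) * hyp2F1 ((1 - k) / 2) (1 - k / 2) 1 (-4 / 121) := by
  set w : ℝ → ℝ := fun s ↦ (1 - s) ^ (k - 1) * s ^ (-k) with hw
  have hw_int : IntegrableOn w (Set.Ioo 0 1) := by
    have := (real_betaIntegral (sub_pos.2 hk1) hk0).1
    refine this.congr_fun (fun x _ ↦ ?_) measurableSet_Ioo
    simp only [hw]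
    ring_nf
  set c : ℕ → ℝ := fun n ↦ (ascPochhammer ℝ n).eval (1 / 2) / n.factorial with hc
  have hc0 (n : ℕ) : 0 < c n := div_pos (ascPochhammer_pos n _ (by norm_num)) (by positivity)
  have hc1 (n : ℕ) : c n ≤ 1 := div_le_one_of_le₀ (ascPochhammer_half_le n) (by positivity)
  set F : ℕ → ℝ → ℝ := fun n s ↦
      c n * (-4 / 121) ^ n * (s ^ (2 * n + 1 - k - 1) * (1 - s) ^ (k - 1))
    with hF
  have hpos (n : ℕ) : 0 < 2 * n + 1 - k := by linarith [n.cast_nonneg (α := ℝ)]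
  have hF_int (n : ℕ) : IntegrableOn (F n) (Set.Ioo 0 1) :=
    (real_betaIntegral (hpos n) hk0).1.const_mul _
  have hF_eq (n : ℕ) {s : ℝ} (hs : s ∈ Set.Ioo (0 : ℝ) 1) :
      F n s = w s * (c n * (-4 * s ^ 2 / 121) ^ n) := by
    have : s ^ (2 * n + 1 - k - 1) = s ^ (-k) * (s ^ 2) ^ n := by
      rw [← pow_mul, ← Real.rpow_natCast, ← Real.rpow_add hs.1]
      push_cast
      ring_nf
    simp only [hF, hw, this]
    rw [mul_div_right_comm, mul_pow]
    ring
  have hF_sum {s : ℝ} (hs : s ∈ Set.Ioo (0 : ℝ) 1) :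
      HasSum (F · s) (w s * (1 + 4 * s ^ 2 / 121) ^ (-1 / 2 : ℝ)) := by
    have h1 : |-4 * s ^ 2 / 121| < 1 := by
      rw [abs_lt]
      constructor <;> nlinarith [hs.1, hs.2]
    have := (hasSum_rpow_neg_half h1).mul_left (w s)
    rw [show 1 - -4 * s ^ 2 / 121 = 1 + 4 * s ^ 2 / 121 by ring] at this
    exact this.congr_fun fun n ↦ hF_eq n hs
  have hF_norm (n : ℕ) {s : ℝ} (hs : s ∈ Set.Ioo (0 : ℝ) 1) : ‖F n s‖ ≤ (4 / 121) ^ n * w s := by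
    have h1 : 0 ≤ 1 - s := by linarith [hs.2]
    have h2 : 0 ≤ w s := mul_nonneg (Real.rpow_nonneg h1 _) (Real.rpow_nonneg hs.1.le _)
    have h3 : |-4 * s ^ 2 / 121| ≤ 4 / 121 := by
      rw [abs_le]
      constructor <;> nlinarith [hs.1, hs.2]
    rw [hF_eq n hs, Real.norm_eq_abs, abs_mul (w s), abs_mul (c n), abs_of_nonneg h2,
      abs_of_pos (hc0 n), abs_pow, mul_comm]
    gcongr
    calc c n * |-4 * s ^ 2 / 121| ^ n ≤ 1 * (4 / 121) ^ n := by
          gcongr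
          exact hc1 n
      _ = _ := one_mul _
  have hF_summable : Summable fun n ↦ ∫ s in Set.Ioo (0 : ℝ) 1, ‖F n s‖ := by
    refine Summable.of_nonneg_of_le (fun n ↦ integral_nonneg fun _ ↦ norm_nonneg _)
      (fun n ↦ setIntegral_mono_on (hF_int n).norm (hw_int.const_mul _) measurableSet_Ioo
        fun s hs ↦ hF_norm n hs) ?_
    simp_rw [integral_const_mul]
    exact (summable_geometric_of_lt_one (by norm_num) (by norm_num)).mul_right _
  constructor
  · refine Integrable.mono' hw_int ?_ ?_
    · exact Measurable.aestronglyMeasurable (by fun_prop)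
    · refine ae_restrict_of_forall_mem measurableSet_Ioo fun s hs ↦ ?_
      have h1 : 0 ≤ 1 - s := by linarith [hs.2]
      have h2 : 0 ≤ w s := mul_nonneg (Real.rpow_nonneg h1 _) (Real.rpow_nonneg hs.1.le _)
      have h3 : 0 ≤ 4 * s ^ 2 / 121 := by positivity
      rw [Real.norm_of_nonneg (mul_nonneg h2 (Real.rpow_nonneg (by positivity) _))]
      exact mul_le_of_le_one_right h2
        (Real.rpow_le_one_of_one_le_of_nonpos (by linarith) (by norm_num))
  · have h := hasSum_integral_of_summable_integral_norm hF_int hF_summable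
    rw [setIntegral_congr_fun measurableSet_Ioo fun s hs ↦ (hF_sum hs).tsum_eq] at h
    rw [← h.tsum_eq, hyp2F1, ← tsum_mul_left]
    refine tsum_congr fun n ↦ ?_
    have h3 := ascPochhammer_pos n (1 / 2 : ℝ) (by norm_num)
    have h5 : Real.Gamma k * Real.Gamma (1 - k) = π / Real.sin (k * π) := by
      rw [Real.Gamma_mul_Gamma_one_sub, mul_comm]
    have h6 := Gamma_ratio hk1 n
    simp only [hF]
    rw [integral_const_mul, (real_betaIntegral (hpos n) hk0).2, sub_add_cancel, mul_div_right_comm,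
      h6, ← h5, ascPochhammer_eval_one]
    simp only [hc]
    field_simp

end LevelFive

theorem integral_fk_zero_one (k : ℝ) (hk0 : 0 < k) (hk1 : k < 1) :
    IntervalIntegrable
        (fun q => eulerF (q ^ 5) ^ (5 - 6 * k) * eulerF q ^ (6 * k - 1) * q ^ (-k))
        volume 0 1 ∧
      ∫ q in (0:ℝ)..1,
          eulerF (q ^ 5) ^ (5 - 6 * k) * eulerF q ^ (6 * k - 1) * q ^ (-k) =
        (11 : ℝ) ^ (k - 1) * (π / Real.sin (k * π)) *
          hyp2F1 ((1 - k) / 2) (1 - k / 2) 1 (-4 / 121) := by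
  obtain ⟨h1, h2⟩ := LevelFive.algebraic_integral hk0 hk1
  have hd (q : ℝ) (hq : q ∈ Set.Ioo (0 : ℝ) 1) :=
    (LevelFive.hasDerivAt_sfun hq.1 hq.2).hasDerivWithinAt (s := Set.Ioo 0 1)
  have hEq : Set.EqOn
      (fun q ↦ eulerF (q ^ 5) ^ (5 - 6 * k) * eulerF q ^ (6 * k - 1) * q ^ (-k)) _
      (Set.Ioo 0 1) := fun q hq ↦ LevelFive.integrand_eq k hq.1 hq.2
  rw [intervalIntegrable_iff_integrableOn_Ioo_of_le zero_le_one,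
    intervalIntegral.integral_of_le zero_le_one, integral_Ioc_eq_integral_Ioo]
  rw [← LevelFive.sfun_image, integrableOn_image_iff_integrableOn_abs_deriv_smul measurableSet_Ioo
    hd LevelFive.sfun_injOn] at h1
  rw [← LevelFive.sfun_image, integral_image_eq_integral_abs_deriv_smul measurableSet_Ioo
    hd LevelFive.sfun_injOn] at h2
  refine ⟨IntegrableOn.congr_fun (h1.const_mul (11 ^ (k - 1))) hEq.symm measurableSet_Ioo, ?_⟩
  rw [setIntegral_congr_fun measurableSet_Ioo hEq, integral_const_mul, h2, mul_assoc]
end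

section
/- ∫_0^1 f(-q)^4 · q^{-5/6} dq = π · 2^{1/6} · (√5 − 1)^{5/6} · ₂F₁(1/6, 1/6; 1; (−123 + 55√5)/2). -/
open MeasureTheory Real

section Serre

open Complex UpperHalfPlane Filter Topology Function ModularForm EisensteinSeries Derivative
open scoped Manifold MatrixGroups

/-- The normalized derivative of a holomorphic, periodic, bounded function vanishes at `i∞`. -/
lemma tendsto_normalizedDeriv_atImInfty {F : ℍ → ℂ} (hper : Periodic (F ∘ ofComplex) (1 : ℝ))
    (hF : MDiff F) (hbdd : IsBoundedAtImInfty F) :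
    Tendsto (normalizedDerivOfComplex F) atImInfty (𝓝 0) := by
  have hdiff := differentiableOn_cuspFunction_ball one_pos hper hF hbdd
  have hD : ∀ z : ℍ, normalizedDerivOfComplex F z =
      Periodic.qParam 1 z * deriv (cuspFunction 1 F) (Periodic.qParam 1 z) := by
    intro z
    have hq : ‖Periodic.qParam 1 (z : ℂ)‖ < 1 := by
      simpa using norm_qParam_lt_one 1 z
    have hc : HasDerivAt (cuspFunction 1 F) (deriv (cuspFunction 1 F) (Periodic.qParam 1 z))
        (Periodic.qParam 1 z) :=
      (differentiableAt_cuspFunction one_pos hper hF hbdd hq).hasDerivAt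
    have hqd : HasDerivAt (fun w : ℂ ↦ Periodic.qParam 1 w)
        (Periodic.qParam 1 z * (2 * π * Complex.I)) z := by
      have := ((hasDerivAt_id (z : ℂ)).const_mul (2 * π * Complex.I)).cexp
      simpa [Periodic.qParam] using this
    have hcomp := hc.comp (z : ℂ) hqd
    have heq : F ∘ ofComplex =ᶠ[𝓝 (z : ℂ)]
        cuspFunction 1 F ∘ fun w : ℂ ↦ Periodic.qParam 1 w := by
      filter_upwards [isOpen_upperHalfPlaneSet.mem_nhds z.2] with w hw
      simpa [ofComplex_apply_of_im_pos hw] using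
        (eq_cuspFunction (h := 1) (ofComplex w) one_ne_zero hper).symm
    rw [normalizedDerivOfComplex, heq.deriv_eq, hcomp.deriv]
    have : (2 * π * Complex.I : ℂ) ≠ 0 := two_pi_I_ne_zero
    field_simp
  have hcont : ContinuousAt (deriv (cuspFunction 1 F)) 0 :=
    ((hdiff.deriv Metric.isOpen_ball).differentiableAt
      (Metric.ball_mem_nhds 0 one_pos)).continuousAt
  have hq := qParam_tendsto_atImInfty one_pos
  have := hq.mul (hcont.tendsto.comp hq)
  rw [zero_mul] at this
  exact this.congr fun z ↦ (hD z).symm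

lemma tendsto_atImInfty_of_hasSum_qExpansion {F : ℍ → ℂ} {c : ℕ → ℂ}
    (hF : ∀ τ : ℍ, HasSum (fun m ↦ c m • Periodic.qParam 1 (τ : ℂ) ^ m) (F τ)) :
    Tendsto F atImInfty (𝓝 (c 0)) := by
  have hb : IsBoundedAtImInfty fun τ : ℍ ↦ (F τ - c 0) / Periodic.qParam 1 (τ : ℂ) := by
    refine isBoundedAtImInfty_of_hasSum_qExpansion (c := fun m ↦ c (m + 1)) one_pos fun τ ↦ ?_
    have h1 := ((hasSum_nat_add_iff' 1).mpr (hF τ)).div_const (Periodic.qParam 1 (τ : ℂ))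
    have hq := Periodic.qParam_ne_zero (h := 1) (τ : ℂ)
    simp only [Finset.range_one, Finset.sum_singleton, pow_zero, smul_eq_mul, mul_one] at h1
    convert! h1 using 2 with m
    simp only [smul_eq_mul]
    field_simp
    ring
  have h0 : Tendsto (fun τ : ℍ ↦ (F τ - c 0) / Periodic.qParam 1 (τ : ℂ) *
      Periodic.qParam 1 (τ : ℂ)) atImInfty (𝓝 0) := by
    have hO := Asymptotics.IsBigO.mul hb
      (Asymptotics.isBigO_refl (fun τ : ℍ ↦ Periodic.qParam 1 (τ : ℂ)) atImInfty).norm_right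
    refine hO.trans_tendsto ?_
    simpa using (qParam_tendsto_atImInfty one_pos).norm
  have := h0.add_const (c 0)
  rw [zero_add] at this
  refine this.congr fun τ ↦ ?_
  rw [div_mul_cancel₀ _ (Periodic.qParam_ne_zero (τ : ℂ)), sub_add_cancel]

lemma tendsto_E2_atImInfty : Tendsto E2 atImInfty (𝓝 1) := by
  refine tendsto_atImInfty_of_hasSum_qExpansion
    (c := fun m ↦ if m = 0 then 1 else -24 * ArithmeticFunction.sigma 1 m) fun τ ↦ ?_
  simpa only [Periodic.qParam, ofReal_one, div_one] using hasSum_qExpansion_E2 (z := τ)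

lemma tendsto_E_atImInfty {k : ℕ} (hk : 3 ≤ k) (hk2 : Even k) :
    Tendsto (ModularForm.E hk) atImInfty (𝓝 1) := by
  rw [← E_qExpansion_coeff_zero hk hk2]
  exact tendsto_atImInfty_of_hasSum_qExpansion
    fun τ ↦ UpperHalfPlane.hasSum_qExpansion one_pos
      (SlashInvariantFormClass.periodic_comp_ofComplex _ one_mem_strictPeriods_SL)
      (ModularFormClass.holo (ModularForm.E hk))
      (ModularFormClass.bdd_at_infty (ModularForm.E hk)) τ

/-- A level one modular form of weight less than `12` that vanishes at `i∞` is zero. -/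
lemma eq_zero_of_weight_lt_twelve {k : ℕ} (hk : k < 12) {F : ℍ → ℂ} (hF : MDiff F)
    (hslash : ∀ γ : SL(2, ℤ), F ∣[(k : ℤ)] γ = F) (hlim : Tendsto F atImInfty (𝓝 0)) :
    F = 0 := by
  let f : CuspForm 𝒮ℒ k :=
    { toFun := F
      slash_action_eq' := by
        rintro A ⟨A, rfl⟩
        exact hslash A
      holo' := hF
      zero_at_cusps' := by
        intro c hc
        rw [Subgroup.IsArithmetic.isCusp_iff_isCusp_SL2Z] at hc
        rw [OnePoint.isZeroAt_iff_forall_SL2Z hc]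
        intro γ _
        rw [hslash]
        exact hlim }
  have : f = 0 := rank_zero_iff_forall_zero.mp
    (CuspForm.rank_eq_zero_of_weight_lt_twelve (by exact_mod_cast hk)) f
  exact congrArg (fun g : CuspForm 𝒮ℒ k ↦ (g : ℍ → ℂ)) this

/-- Ramanujan's identity for the derivative of `E₆`. -/
lemma serreDerivative_E₆ (z : ℍ) :
    serreDerivative 6 E₆ z = -E₄ z ^ 2 / 2 := by
  have h6 : MDiff (E₆ : ℍ → ℂ) := ModularFormClass.holo E₆
  have h4 : MDiff (E₄ : ℍ → ℂ) := ModularFormClass.holo E₄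
  have hs6 : ∀ γ : SL(2, ℤ), (E₆ : ℍ → ℂ) ∣[(6 : ℤ)] γ = E₆ := fun γ ↦
    SlashInvariantForm.slash_action_eqn E₆ γ ⟨γ, rfl⟩
  have hs4 : ∀ γ : SL(2, ℤ), (E₄ : ℍ → ℂ) ∣[(4 : ℤ)] γ = E₄ := fun γ ↦
    SlashInvariantForm.slash_action_eqn E₄ γ ⟨γ, rfl⟩
  have key : serreDerivative 6 E₆ + (1 / 2 : ℂ) • ((E₄ : ℍ → ℂ) * E₄) = 0 := by
    refine eq_zero_of_weight_lt_twelve (k := 8) (by norm_num) ?_ ?_ ?_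
    · exact (serreDerivative_mdifferentiable 6 h6).add ((h4.mul h4).const_smul _)
    · intro γ
      have e1 := serreDerivative_slash_invariant (k := 6) h6 (hs6 γ)
      rw [Int.cast_ofNat] at e1
      replace e1 : serreDerivative 6 E₆ ∣[(8 : ℤ)] γ = serreDerivative 6 E₆ := e1
      have e2 := mul_slash_SL2 4 4 γ (E₄ : ℍ → ℂ) E₄
      rw [hs4] at e2
      replace e2 : ((E₄ : ℍ → ℂ) * E₄) ∣[(8 : ℤ)] γ = (E₄ : ℍ → ℂ) * E₄ := e2
      push_cast
      rw [SlashAction.add_slash, e1, SL_smul_slash, e2]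
    · have hD := tendsto_normalizedDeriv_atImInfty
        (SlashInvariantFormClass.periodic_comp_ofComplex E₆ one_mem_strictPeriods_SL) h6
        (ModularFormClass.bdd_at_infty E₆)
      have l6 := tendsto_E_atImInfty (k := 6) (by norm_num) ⟨3, rfl⟩
      have l4 := tendsto_E_atImInfty (k := 4) (by norm_num) ⟨2, rfl⟩
      have := (hD.sub ((tendsto_E2_atImInfty.const_mul (6 * 12⁻¹)).mul l6)).add
        ((l4.mul l4).const_mul (1 / 2))
      norm_num at this
      convert! this using 2 with τ
      simp
      norm_num
  have := congrFun key z
  simp only [Pi.add_apply, Pi.smul_apply, Pi.mul_apply, Pi.zero_apply, smul_eq_mul] at this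
  linear_combination this

end Serre

section Substitution

open Set Filter Topology

/-- A strictly decreasing function on an interval that is unbounded near both ends is onto. -/
lemma StrictAntiOn.image_Ioo_eq_univ {a b : ℝ} (hab : a < b) {G : ℝ → ℝ}
    (hG : StrictAntiOn G (Ioo a b)) (hc : ContinuousOn G (Ioo a b))
    (ha : Tendsto (fun x ↦ |G x|) (𝓝[>] a) atTop) (hb : Tendsto (fun x ↦ |G x|) (𝓝[<] b) atTop) :
    G '' Ioo a b = univ := by
  obtain ⟨c, hc1, hc2⟩ := exists_between hab
  refine eq_univ_of_forall fun y ↦ ?_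
  obtain ⟨p, hp, hpa⟩ := ((ha.eventually_gt_atTop (max |G c| |y|)).and
    (Ioo_mem_nhdsGT hc1)).exists
  obtain ⟨r, hr, hrb⟩ := ((hb.eventually_gt_atTop (max |G c| |y|)).and
    (Ioo_mem_nhdsLT hc2)).exists
  have hpI : p ∈ Ioo a b := ⟨hpa.1, hpa.2.trans hc2⟩
  have hrI : r ∈ Ioo a b := ⟨hc1.trans hrb.1, hrb.2⟩
  have hpc := hG hpI ⟨hc1, hc2⟩ hpa.2
  have hcr := hG ⟨hc1, hc2⟩ hrI hrb.1
  have hyp : y < G p := by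
    rcases lt_abs.mp ((le_max_right _ _).trans_lt hp) with h | h <;>
    rcases lt_abs.mp ((le_max_left _ _).trans_lt hp) with h' | h' <;>
    linarith [le_abs_self y, neg_abs_le y, le_abs_self (G c), neg_abs_le (G c)]
  have hyr : G r < y := by
    rcases lt_abs.mp ((le_max_right _ _).trans_lt hr) with h | h <;>
    rcases lt_abs.mp ((le_max_left _ _).trans_lt hr) with h' | h' <;>
    linarith [le_abs_self y, neg_abs_le y, le_abs_self (G c), neg_abs_le (G c)]
  exact isPreconnected_Ioo.intermediate_value hrI hpI hc ⟨hyr.le, hyp.le⟩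

/-- If `(X, G)` parametrizes the elliptic curve `x³ = y² + 1728` over an interval, then the
pullback of the invariant differential has integral `2 ∫ (y² + 1728) ^ (-2/3) dy`. -/
lemma integral_eq_of_parametrization {a b : ℝ} (hab : a < b) {G X w d : ℝ → ℝ}
    (hG : ∀ x ∈ Ioo a b, HasDerivAt G (-(X x ^ 2 * w x) / 2) x)
    (hX : ∀ x ∈ Ioo a b, 0 < X x) (hw : ∀ x ∈ Ioo a b, 0 < w x)
    (hXG : ∀ x ∈ Ioo a b, X x ^ 3 = G x ^ 2 + 1728)
    (hd : ∀ x ∈ Ioo a b, 0 < d x) (hdX : ∀ x ∈ Ioo a b, (d x)⁻¹ ≤ X x ^ 3)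
    (hda : Tendsto d (𝓝[>] a) (𝓝 0)) (hdb : Tendsto d (𝓝[<] b) (𝓝 0)) :
    ∫ x in a..b, w x = 2 * ∫ y : ℝ, (y ^ 2 + 1728) ^ (-(2 : ℝ) / 3) := by
  have habs {l : Filter ℝ} (hl : Tendsto d l (𝓝 0)) (hI : Ioo a b ∈ l) :
      Tendsto (fun x ↦ |G x|) l atTop := by
    have h1 : Tendsto d l (𝓝[>] 0) := tendsto_nhdsWithin_iff.mpr
      ⟨hl, by filter_upwards [hI] with x hx using hd x hx⟩
    have h2 := tendsto_atTop_add_const_right l (-1728 : ℝ) (tendsto_inv_nhdsGT_zero.comp h1)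
    refine tendsto_atTop_mono' l ?_ (tendsto_sqrt_atTop.comp h2)
    filter_upwards [hI] with x hx
    refine sqrt_le_iff.mpr ⟨abs_nonneg _, ?_⟩
    rw [sq_abs]
    have := hdX x hx
    rw [hXG x hx] at this
    simpa using this
  have hcont : ContinuousOn G (Ioo a b) := fun x hx ↦ (hG x hx).continuousAt.continuousWithinAt
  have hanti : StrictAntiOn G (Ioo a b) := by
    refine strictAntiOn_of_deriv_neg (convex_Ioo a b) hcont fun x hx ↦ ?_
    rw [interior_Ioo] at hx
    rw [(hG x hx).deriv]
    have := mul_pos (pow_pos (hX x hx) 2) (hw x hx)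
    linarith
  have himage := hanti.image_Ioo_eq_univ hab hcont (habs hda (Ioo_mem_nhdsGT hab))
    (habs hdb (Ioo_mem_nhdsLT hab))
  have hsub := integral_image_eq_integral_abs_deriv_smul measurableSet_Ioo
    (fun x hx ↦ (hG x hx).hasDerivWithinAt) hanti.injOn
    (fun y : ℝ ↦ (y ^ 2 + 1728) ^ (-(2 : ℝ) / 3))
  rw [himage, Measure.restrict_univ] at hsub
  rw [hsub, intervalIntegral.integral_of_le hab.le, integral_Ioc_eq_integral_Ioo,
    ← integral_const_mul]
  refine setIntegral_congr_fun measurableSet_Ioo fun x hx ↦ ?_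
  have hXx := hX x hx
  have hpow : (G x ^ 2 + 1728) ^ (-(2 : ℝ) / 3) = (X x ^ 2)⁻¹ := by
    rw [← hXG x hx, ← rpow_natCast, ← rpow_mul hXx.le]
    norm_num
  have hneg : -(X x ^ 2 * w x) / 2 < 0 := by
    have := mul_pos (pow_pos hXx 2) (hw x hx)
    linarith
  simp only [smul_eq_mul]
  rw [abs_of_neg hneg, hpow]
  field_simp

end Substitution

section EulerProduct

open Filter Topology

lemma multipliable_eulerF {q : ℝ} (h0 : 0 < q) (h1 : q < 1) :
    Multipliable fun n : ℕ ↦ 1 - q ^ (n + 1) := by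
  have : Summable fun n : ℕ ↦ ‖-q ^ (n + 1)‖ := by
    simpa [abs_of_pos h0] using (summable_nat_add_iff 1).mpr
      (summable_geometric_of_lt_one h0.le h1)
  simpa [sub_eq_add_neg] using multipliable_one_add_of_summable this

lemma eulerF_mem_Ioc {q : ℝ} (h0 : 0 < q) (h1 : q < 1) :
    eulerF q ∈ Set.Ioc 0 (1 - q) := by
  have hlim := (multipliable_eulerF h0 h1).hasProd.tendsto_prod_nat
  have hfac (n : ℕ) : 0 < 1 - q ^ (n + 1) := sub_pos.mpr (pow_lt_one₀ h0.le h1 n.succ_ne_zero)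
  have hnn : 0 ≤ eulerF q := ge_of_tendsto' hlim fun n ↦ Finset.prod_nonneg fun i _ ↦ (hfac i).le
  have hne : eulerF q ≠ 0 := by
    have : Summable fun n : ℕ ↦ ‖-q ^ (n + 1)‖ := by
      simpa [abs_of_pos h0] using (summable_nat_add_iff 1).mpr
        (summable_geometric_of_lt_one h0.le h1)
    simpa [eulerF, sub_eq_add_neg] using tprod_one_add_ne_zero_of_summable (R := ℝ)
      (f := fun n : ℕ ↦ -q ^ (n + 1))
      (fun n ↦ by simpa [sub_eq_add_neg] using (hfac n).ne') this
  refine ⟨lt_of_le_of_ne hnn hne.symm, le_of_tendsto hlim ?_⟩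
  filter_upwards [eventually_ge_atTop 1] with n hn
  obtain ⟨m, rfl⟩ := Nat.exists_eq_add_of_le' hn
  rw [Finset.prod_range_succ']
  have : ∏ k ∈ Finset.range m, (1 - q ^ (k + 1 + 1)) ≤ 1 :=
    Finset.prod_le_one (fun i _ ↦ (hfac _).le) fun i _ ↦ by linarith [pow_pos h0 (i + 1 + 1)]
  simpa using mul_le_of_le_one_left (hfac 0).le this

lemma ofReal_eulerF {q : ℝ} (h0 : 0 < q) (h1 : q < 1) :
    (eulerF q : ℂ) = ∏' n : ℕ, (1 - (q : ℂ) ^ (n + 1)) := by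
  have := (multipliable_eulerF h0 h1).map_tprod Complex.ofRealHom Complex.continuous_ofReal
  simpa [eulerF] using this

end EulerProduct

section ImaginaryAxis

open Complex UpperHalfPlane Filter Topology Function ModularForm EisensteinSeries Derivative
open scoped Manifold MatrixGroups

/-- The logarithmic coordinate `τ = log q / (2 π i)`. -/
noncomputable def nomeLog (q : ℝ) : ℂ := Real.log q / (2 * π * Complex.I)

lemma nomeLog_im_pos {q : ℝ} (h0 : 0 < q) (h1 : q < 1) : 0 < (nomeLog q).im := by
  have h : nomeLog q = ((-Real.log q / (2 * π) : ℝ) : ℂ) * Complex.I := by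
    have hπ : (π : ℂ) ≠ 0 := ofReal_ne_zero.mpr pi_ne_zero
    rw [nomeLog]
    push_cast
    field_simp
    rw [Complex.I_sq]
    ring
  rw [h, Complex.im_ofReal_mul, Complex.I_im, mul_one]
  exact div_pos (neg_pos.mpr (Real.log_neg h0 h1)) (by positivity)

lemma cexp_nomeLog {q : ℝ} (h0 : 0 < q) : cexp (2 * π * Complex.I * nomeLog q) = q := by
  have : (2 * π * Complex.I : ℂ) ≠ 0 := two_pi_I_ne_zero
  rw [nomeLog, mul_div_cancel₀ _ this, ← ofReal_exp, Real.exp_log h0]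

lemma hasDerivAt_nomeLog {q : ℝ} (h0 : 0 < q) :
    HasDerivAt nomeLog ((q : ℂ)⁻¹ / (2 * π * Complex.I)) q := by
  have := ((Real.hasDerivAt_log h0.ne').ofReal_comp).div_const (2 * π * Complex.I)
  rwa [ofReal_inv] at this

/-- The Dedekind eta function in terms of the nome. -/
noncomputable def etaNome (q : ℝ) : ℝ := q ^ ((1 : ℝ) / 24) * eulerF q

lemma etaNome_pos {q : ℝ} (h0 : 0 < q) (h1 : q < 1) : 0 < etaNome q :=
  mul_pos (rpow_pos_of_pos h0 _) (eulerF_mem_Ioc h0 h1).1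

lemma eta_nomeLog {q : ℝ} (h0 : 0 < q) (h1 : q < 1) : ModularForm.eta (nomeLog q) = etaNome q := by
  have hq : Periodic.qParam 24 (nomeLog q) = ((q ^ ((1 : ℝ) / 24) : ℝ) : ℂ) := by
    have : (2 * π * Complex.I : ℂ) ≠ 0 := two_pi_I_ne_zero
    rw [Periodic.qParam, nomeLog, mul_div_cancel₀ _ this, Real.rpow_def_of_pos h0]
    push_cast
    ring_nf
  rw [ModularForm.eta, etaNome, hq, ofReal_mul, ofReal_eulerF h0 h1]
  simp only [eta_q_eq_pow, cexp_nomeLog h0]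

lemma exists_E_nomeLog {k : ℕ} (hk : 3 ≤ k) (hk2 : Even k) {q : ℝ} (h0 : 0 < q) (h1 : q < 1) :
    ∃ s : ℝ, 0 ≤ s ∧ ModularForm.E hk (ofComplex (nomeLog q)) =
      ((1 - (2 * k / bernoulli k : ℚ) * s : ℝ) : ℂ) := by
  refine ⟨∑' n : ℕ+, ArithmeticFunction.sigma (k - 1) n * q ^ (n : ℤ),
    tsum_nonneg fun n ↦ by positivity, ?_⟩
  rw [q_expansion_bernoulli hk hk2, ofComplex_apply_of_im_pos (nomeLog_im_pos h0 h1)]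
  push_cast
  simp only [cexp_nomeLog h0]

/-- `E₄` in terms of the nome. -/
noncomputable def E₄Nome (q : ℝ) : ℝ := (E₄ (ofComplex (nomeLog q))).re

/-- `E₆` in terms of the nome. -/
noncomputable def E₆Nome (q : ℝ) : ℝ := (E₆ (ofComplex (nomeLog q))).re

lemma E₄_nomeLog {q : ℝ} (h0 : 0 < q) (h1 : q < 1) :
    E₄ (ofComplex (nomeLog q)) = E₄Nome q := by
  obtain ⟨s, -, hs⟩ := exists_E_nomeLog (k := 4) (by norm_num) ⟨2, rfl⟩ h0 h1
  rw [E₄Nome, E₄, hs, ofReal_re]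

lemma E₆_nomeLog {q : ℝ} (h0 : 0 < q) (h1 : q < 1) :
    E₆ (ofComplex (nomeLog q)) = E₆Nome q := by
  obtain ⟨s, -, hs⟩ := exists_E_nomeLog (k := 6) (by norm_num) ⟨3, rfl⟩ h0 h1
  rw [E₆Nome, E₆, hs, ofReal_re]

lemma one_le_E₄Nome {q : ℝ} (h0 : 0 < q) (h1 : q < 1) : 1 ≤ E₄Nome q := by
  obtain ⟨s, h, hs⟩ := exists_E_nomeLog (k := 4) (by norm_num) ⟨2, rfl⟩ h0 h1
  rw [E₄Nome, E₄, hs, ofReal_re, show bernoulli 4 = -1 / 30 by decide +kernel]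
  norm_num
  exact h

lemma E₄Nome_cube_sub_E₆Nome_sq {q : ℝ} (h0 : 0 < q) (h1 : q < 1) :
    E₄Nome q ^ 3 - E₆Nome q ^ 2 = 1728 * etaNome q ^ 24 := by
  have h := discriminant_eq_E₄_cube_sub_E₆_sq (ofComplex (nomeLog q))
  rw [ModularForm.discriminant, E₄_nomeLog h0 h1, E₆_nomeLog h0 h1,
    ofComplex_apply_of_im_pos (nomeLog_im_pos h0 h1), UpperHalfPlane.coe_mk,
    eta_nomeLog h0 h1] at h
  norm_cast at h
  linarith

lemma hasDerivAt_E₆_div_eta_pow (z : ℍ) :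
    HasDerivAt (fun w : ℂ ↦ E₆ (ofComplex w) / ModularForm.eta w ^ 12)
      (-(π * Complex.I) * E₄ z ^ 2 / ModularForm.eta z ^ 12) z := by
  have hη := eta_ne_zero z.2
  have hdη : HasDerivAt ModularForm.eta (ModularForm.eta z * (π * Complex.I / 12 * E2 z)) z := by
    convert! (differentiableAt_eta_of_mem_upperHalfPlaneSet z.2).hasDerivAt using 1
    rw [← logDeriv_eta_eq_E2, logDeriv_apply]
    field_simp
  have hE : HasDerivAt (fun w : ℂ ↦ E₆ (ofComplex w))
      (2 * π * Complex.I * (-E₄ z ^ 2 / 2 + E2 z * E₆ z / 2)) z := by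
    have hd : DifferentiableAt ℂ (E₆ ∘ ofComplex) z :=
      UpperHalfPlane.mdifferentiableAt_iff.mp (ModularFormClass.holo E₆ z)
    convert! hd.hasDerivAt using 1
    have h := serreDerivative_E₆ z
    rw [serreDerivative_apply, normalizedDerivOfComplex] at h
    rw [← h]
    have : (2 * π * Complex.I : ℂ) ≠ 0 := two_pi_I_ne_zero
    field_simp
    ring
  convert! hE.fun_div (hdη.fun_pow 12) (pow_ne_zero 12 hη) using 1
  simp only [ofComplex_apply]
  field_simp
  ring

lemma hasDerivAt_E₆Nome_div {q : ℝ} (h0 : 0 < q) (h1 : q < 1) :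
    HasDerivAt (fun x ↦ (E₆ (ofComplex (nomeLog x)) / ModularForm.eta (nomeLog x) ^ 12).re)
      (-((E₄Nome q / etaNome q ^ 8) ^ 2 * (etaNome q ^ 4 / q)) / 2) q := by
  have hz := nomeLog_im_pos h0 h1
  have h := hasDerivAt_E₆_div_eta_pow ⟨nomeLog q, hz⟩
  have hc := Complex.reCLM.hasFDerivAt.comp_hasDerivAt q
    (h.comp q (hasDerivAt_nomeLog h0))
  convert! hc using 1
  have hη : (etaNome q : ℂ) ≠ 0 := ofReal_ne_zero.mpr (etaNome_pos h0 h1).ne'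
  have hq : (q : ℂ) ≠ 0 := ofReal_ne_zero.mpr h0.ne'
  have hπ : (π : ℂ) ≠ 0 := ofReal_ne_zero.mpr pi_ne_zero
  rw [← ofComplex_apply_of_im_pos hz, E₄_nomeLog h0 h1, ofComplex_apply_of_im_pos hz,
    UpperHalfPlane.coe_mk, eta_nomeLog h0 h1]
  apply ofReal_injective
  rw [reCLM_apply, show -(π * Complex.I) * (E₄Nome q : ℂ) ^ 2 / (etaNome q : ℂ) ^ 12 *
    ((q : ℂ)⁻¹ / (2 * π * Complex.I)) =
    ((-((E₄Nome q / etaNome q ^ 8) ^ 2 * (etaNome q ^ 4 / q)) / 2 : ℝ) : ℂ) by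
      push_cast
      field_simp, ofReal_re]

lemma etaNome_pow_four_div {q : ℝ} (h0 : 0 < q) :
    etaNome q ^ 4 / q = eulerF q ^ 4 * q ^ (-(5 : ℝ) / 6) := by
  have : (q ^ ((1 : ℝ) / 24)) ^ 4 = q * q ^ (-(5 : ℝ) / 6) := by
    rw [← rpow_natCast, ← rpow_mul h0.le, ← rpow_one_add' h0.le (by norm_num)]
    norm_num
  rw [etaNome, mul_pow, this]
  field_simp

lemma etaNome_pow_twentyfour_le {q : ℝ} (h0 : 0 < q) (h1 : q < 1) :
    etaNome q ^ 24 ≤ q * (1 - q) := by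
  obtain ⟨hf0, hf1⟩ := eulerF_mem_Ioc h0 h1
  have : (q ^ ((1 : ℝ) / 24)) ^ 24 = q := by
    rw [← rpow_natCast, ← rpow_mul h0.le]
    norm_num
  rw [etaNome, mul_pow, this]
  gcongr
  calc eulerF q ^ 24 ≤ eulerF q := pow_le_of_le_one hf0.le (by linarith) (by norm_num)
    _ ≤ 1 - q := hf1

/-- The integral of the eta quotient in terms of the invariant differential on
`x³ = y² + 1728`. -/
lemma integral_eulerF_pow_four :
    ∫ q in (0 : ℝ)..1, eulerF q ^ 4 * q ^ (-(5 : ℝ) / 6) =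
      2 * ∫ y : ℝ, (y ^ 2 + 1728) ^ (-(2 : ℝ) / 3) := by
  have hlim (c : ℝ) (hc : c * (1 - c) = 0) (s : Set ℝ) :
      Tendsto (fun q : ℝ ↦ q * (1 - q)) (𝓝[s] c) (𝓝 0) := by
    rw [← hc]
    exact Continuous.continuousWithinAt (by fun_prop)
  refine integral_eq_of_parametrization (zero_lt_one)
    (G := fun x ↦ (E₆ (ofComplex (nomeLog x)) / ModularForm.eta (nomeLog x) ^ 12).re)
    (X := fun q ↦ E₄Nome q / etaNome q ^ 8) (d := fun q ↦ q * (1 - q)) ?_ ?_ ?_ ?_ ?_ ?_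
    (hlim 0 (by norm_num) _) (hlim 1 (by norm_num) _)
  all_goals rintro q ⟨h0, h1⟩
  · rw [← etaNome_pow_four_div h0]
    exact hasDerivAt_E₆Nome_div h0 h1
  · exact div_pos (by linarith [one_le_E₄Nome h0 h1]) (pow_pos (etaNome_pos h0 h1) 8)
  · exact mul_pos (pow_pos (eulerF_mem_Ioc h0 h1).1 4) (rpow_pos_of_pos h0 _)
  · have hη := (etaNome_pos h0 h1).ne'
    have h := E₄Nome_cube_sub_E₆Nome_sq h0 h1
    rw [E₆_nomeLog h0 h1, eta_nomeLog h0 h1, ← ofReal_pow, ← ofReal_div, ofReal_re]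
    field_simp
    linarith
  · exact mul_pos h0 (sub_pos.mpr h1)
  · have hη := etaNome_pos h0 h1
    calc (q * (1 - q))⁻¹ ≤ (etaNome q ^ 24)⁻¹ :=
          inv_anti₀ (pow_pos hη 24) (etaNome_pow_twentyfour_le h0 h1)
      _ = 1 ^ 3 / etaNome q ^ 24 := by norm_num
      _ ≤ E₄Nome q ^ 3 / etaNome q ^ 24 := by
          gcongr
          exact one_le_E₄Nome h0 h1
      _ = (E₄Nome q / etaNome q ^ 8) ^ 3 := by rw [div_pow, ← pow_mul]

end ImaginaryAxis

section Icosahedral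

open Filter Topology Set

/-- The integral over the icosahedral parametrization of the curve `x³ = y² + 1728`. -/
lemma integral_icosahedral {a : ℝ} (ha : 0 < a) (ha' : 1 - 11 * a - a ^ 2 = 0) :
    ∫ u in (0 : ℝ)..a, u ^ (-(5 : ℝ) / 6) * (1 - 11 * u - u ^ 2) ^ (-(1 : ℝ) / 6) =
      2 * ∫ y : ℝ, (y ^ 2 + 1728) ^ (-(2 : ℝ) / 3) := by
  have hs {u : ℝ} (hu : u ∈ Ioo 0 a) : 0 < 1 - 11 * u - u ^ 2 := by nlinarith [hu.1, hu.2]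
  have hN {u : ℝ} (hu : u ∈ Ioo 0 a) :
      1 ≤ u ^ 4 + 1 - 228 * (u ^ 3 - u) + 494 * u ^ 2 := by
    have hu1 : u ^ 2 < 1 := by linarith [hs hu, hu.1]
    nlinarith [mul_pos hu.1 (sub_pos.mpr hu1), pow_pos hu.1 4, pow_pos hu.1 2]
  have hlim (c : ℝ) (hc : c * (1 - 11 * c - c ^ 2) ^ 5 = 0) (t : Set ℝ) :
      Tendsto (fun u : ℝ ↦ u * (1 - 11 * u - u ^ 2) ^ 5) (𝓝[t] c) (𝓝 0) := by
    rw [← hc]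
    exact Continuous.continuousWithinAt (by fun_prop)
  have hpow {t : ℝ} (ht : 0 < t) (r p : ℝ) (n : ℕ) (h : r * n = p) : (t ^ r) ^ n = t ^ p := by
    rw [← rpow_natCast, ← rpow_mul ht.le, h]
  refine integral_eq_of_parametrization ha
    (G := fun u ↦ (u ^ 6 + 1 + 522 * (u ^ 5 - u) - 10005 * (u ^ 4 + u ^ 2)) *
      u ^ (-(1 : ℝ) / 2) * (1 - 11 * u - u ^ 2) ^ (-(5 : ℝ) / 2))
    (X := fun u ↦ (u ^ 4 + 1 - 228 * (u ^ 3 - u) + 494 * u ^ 2) *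
      u ^ (-(1 : ℝ) / 3) * (1 - 11 * u - u ^ 2) ^ (-(5 : ℝ) / 3))
    (d := fun u ↦ u * (1 - 11 * u - u ^ 2) ^ 5) ?_ ?_ ?_ ?_ ?_ ?_
    (hlim 0 (by ring) _) (hlim a (by rw [ha']; ring) _)
  all_goals
    intro u hu
    have hu0 := hu.1
    have hsu := hs hu
    have hNu := hN hu
    have hs0 : 1 - u * 11 - u ^ 2 ≠ 0 := by rw [mul_comm u]; exact hsu.ne'
    have hX3 : ((u ^ 4 + 1 - 228 * (u ^ 3 - u) + 494 * u ^ 2) *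
        u ^ (-(1 : ℝ) / 3) * (1 - 11 * u - u ^ 2) ^ (-(5 : ℝ) / 3)) ^ 3 =
        (u ^ 4 + 1 - 228 * (u ^ 3 - u) + 494 * u ^ 2) ^ 3 *
          (u * (1 - 11 * u - u ^ 2) ^ 5)⁻¹ := by
      rw [mul_pow, mul_pow, hpow hu0 _ (-1) 3 (by norm_num), hpow hsu _ (-(5 : ℕ)) 3 (by norm_num),
        rpow_neg_one, rpow_neg hsu.le, rpow_natCast, mul_inv, mul_assoc]
  · have hM : HasDerivAt (fun u : ℝ ↦ u ^ 6 + 1 + 522 * (u ^ 5 - u) - 10005 * (u ^ 4 + u ^ 2))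
        (6 * u ^ 5 + 522 * (5 * u ^ 4 - 1) - 10005 * (4 * u ^ 3 + 2 * u)) u := by
      convert! (((hasDerivAt_pow 6 u).add_const 1).add
        (((hasDerivAt_pow 5 u).sub (hasDerivAt_id u)).const_mul 522)).sub
        (((hasDerivAt_pow 4 u).add (hasDerivAt_pow 2 u)).const_mul 10005) using 1
      norm_num
    have hd : HasDerivAt (fun u : ℝ ↦ 1 - 11 * u - u ^ 2) (-11 - 2 * u) u := by
      convert! (((hasDerivAt_id u).const_mul 11).const_sub 1).sub (hasDerivAt_pow 2 u) using 1
      norm_num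
    convert! (hM.fun_mul (hasDerivAt_rpow_const (p := -(1 : ℝ) / 2) (Or.inl hu0.ne'))).fun_mul
      (hd.rpow_const (p := -(5 : ℝ) / 2) (Or.inl hsu.ne')) using 1
    rw [rpow_sub_one hu0.ne', rpow_sub_one hsu.ne', mul_pow, mul_pow,
      hpow hu0 _ (-(2 : ℝ) / 3) 2 (by norm_num), hpow hsu _ (-(10 : ℝ) / 3) 2 (by norm_num)]
    have h1 : u ^ (-(2 : ℝ) / 3) * u ^ (-(5 : ℝ) / 6) = u ^ (-(1 : ℝ) / 2) / u := by
      rw [← rpow_add hu0, ← rpow_sub_one hu0.ne']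
      norm_num
    have h2 : (1 - 11 * u - u ^ 2) ^ (-(10 : ℝ) / 3) * (1 - 11 * u - u ^ 2) ^ (-(1 : ℝ) / 6) =
        (1 - 11 * u - u ^ 2) ^ (-(5 : ℝ) / 2) / (1 - 11 * u - u ^ 2) := by
      rw [← rpow_add hsu, ← rpow_sub_one hsu.ne']
      norm_num
    trans -((u ^ 4 + 1 - 228 * (u ^ 3 - u) + 494 * u ^ 2) ^ 2 * ((u ^ (-(1 : ℝ) / 2) / u) *
      ((1 - 11 * u - u ^ 2) ^ (-(5 : ℝ) / 2) / (1 - 11 * u - u ^ 2)))) / 2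
    · rw [← h1, ← h2]
      ring
    · field_simp
      ring
  · positivity
  · positivity
  · rw [hX3, mul_pow, mul_pow, hpow hu0 _ (-1) 2 (by norm_num),
      hpow hsu _ (-(5 : ℕ)) 2 (by norm_num), rpow_neg_one, rpow_neg hsu.le, rpow_natCast]
    field_simp
    ring
  · positivity
  · rw [hX3]
    exact le_mul_of_one_le_left (by positivity) (one_le_pow₀ hNu)

end Icosahedral

section EulerIntegral

open Filter Set

lemma hasSum_one_sub_rpow_neg (r : ℝ) {x : ℝ} (hx : |x| < 1) :
    HasSum (fun n : ℕ ↦ (ascPochhammer ℝ n).eval r / n.factorial * x ^ n) ((1 - x) ^ (-r)) := by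
  have h := (one_div_one_sub_rpow_hasFPowerSeriesOnBall_zero r).hasSum (y := x)
    (by simpa [enorm_eq_nnnorm, ← NNReal.coe_lt_coe] using hx)
  simp only [FormalMultilinearSeries.ofScalars_apply_eq, zero_add, smul_eq_mul, one_div] at h
  rw [rpow_neg (by linarith [le_abs_self x])]
  convert! h using 2 with n
  have hm := Ring.factorial_nsmul_multichoose_eq_ascPochhammer r n
  rw [Ring.multichoose_eq, Polynomial.ascPochhammer_smeval_eq_eval, nsmul_eq_mul] at hm
  rw [← hm, mul_div_cancel_left₀ _ (Nat.cast_ne_zero.mpr n.factorial_ne_zero)]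

/-- The real Beta integral. -/
lemma integral_rpow_mul_one_sub_rpow {s t : ℝ} (hs : 0 < s) (ht : 0 < t) :
    ∫ x in (0 : ℝ)..1, x ^ (s - 1) * (1 - x) ^ (t - 1) =
      Real.Gamma s * Real.Gamma t / Real.Gamma (s + t) := by
  have h := ProbabilityTheory.beta_eq_betaIntegralReal s t hs ht
  rw [ProbabilityTheory.beta] at h
  rw [h, Complex.betaIntegral, ← Complex.ofReal_re (∫ x in (0 : ℝ)..1, _),
    ← intervalIntegral.integral_ofReal]
  congr 1
  refine intervalIntegral.integral_congr fun x hx ↦ ?_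
  rw [uIcc_of_le zero_le_one] at hx
  simp [Complex.ofReal_cpow hx.1, Complex.ofReal_cpow (sub_nonneg.mpr hx.2)]

lemma intervalIntegrable_rpow_mul_one_sub_rpow {s t : ℝ} (hs : 0 < s) (ht : 0 < t) :
    IntervalIntegrable (fun x : ℝ ↦ x ^ (s - 1) * (1 - x) ^ (t - 1)) volume 0 1 := by
  refine intervalIntegral.intervalIntegrable_of_integral_ne_zero ?_
  rw [integral_rpow_mul_one_sub_rpow hs ht]
  have := Real.Gamma_pos_of_pos hs
  have := Real.Gamma_pos_of_pos ht
  have := Real.Gamma_pos_of_pos (add_pos hs ht)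
  positivity

lemma Gamma_add_nat_eq {r : ℝ} (hr : 0 < r) (n : ℕ) :
    Real.Gamma (r + n) = (ascPochhammer ℝ n).eval r * Real.Gamma r := by
  induction n with
  | zero => simp
  | succ n ih =>
    rw [Nat.cast_succ, ← add_assoc, Real.Gamma_add_one (by positivity), ih,
      ascPochhammer_succ_eval]
    ring

/-- Euler's integral for `₂F₁(r, r; 1; z)`. -/
lemma integral_eq_hyp2F1 {r z : ℝ} (hr0 : 0 < r) (hr1 : r < 1) (hz : |z| < 1) :
    ∫ x in (0 : ℝ)..1, x ^ (r - 1) * (1 - x) ^ (-r) * (1 - z * x) ^ (-r) =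
      π / sin (π * r) * hyp2F1 r r 1 z := by
  have hc (n : ℕ) : 0 ≤ (ascPochhammer ℝ n).eval r / n.factorial :=
    div_nonneg (ascPochhammer_pos n r hr0).le n.factorial.cast_nonneg
  have hsum := hasSum_one_sub_rpow_neg r (x := |z|) (by rwa [abs_abs])
  have hint := intervalIntegrable_rpow_mul_one_sub_rpow hr0 (sub_pos.mpr hr1)
  rw [sub_sub_cancel_left] at hint
  have key := intervalIntegral.hasSum_integral_of_dominated_convergence (μ := volume)
    (a := 0) (b := 1)
    (F := fun n x ↦ x ^ (r - 1) * (1 - x) ^ (-r) *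
      ((ascPochhammer ℝ n).eval r / n.factorial * (z * x) ^ n))
    (f := fun x ↦ x ^ (r - 1) * (1 - x) ^ (-r) * (1 - z * x) ^ (-r))
    (fun n x ↦ x ^ (r - 1) * (1 - x) ^ (-r) *
      ((ascPochhammer ℝ n).eval r / n.factorial * |z| ^ n))
    (fun n ↦ by fun_prop) ?_ ?_ ?_ ?_
  · rw [← key.tsum_eq, hyp2F1, ← tsum_mul_left]
    refine tsum_congr fun n ↦ ?_
    have hn := integral_rpow_mul_one_sub_rpow (s := r + n) (t := 1 - r) (by positivity)
      (sub_pos.mpr hr1)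
    rw [show r + n + (1 - r) = n + 1 by ring, Real.Gamma_nat_eq_factorial, Gamma_add_nat_eq hr0,
      mul_assoc, Real.Gamma_mul_Gamma_one_sub, sub_sub_cancel_left] at hn
    rw [ascPochhammer_eval_one]
    trans (ascPochhammer ℝ n).eval r / n.factorial * z ^ n *
      ∫ x in (0 : ℝ)..1, x ^ (r + n - 1) * (1 - x) ^ (-r)
    · rw [← intervalIntegral.integral_const_mul]
      refine intervalIntegral.integral_congr_ae (ae_of_all _ fun x hx ↦ ?_)
      rw [uIoc_of_le zero_le_one] at hx
      rw [add_sub_right_comm, rpow_add hx.1, rpow_natCast]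
      ring
    · rw [hn]
      field_simp
  · refine fun n ↦ ae_of_all _ fun x hx ↦ ?_
    rw [uIoc_of_le zero_le_one] at hx
    have h1 := sub_nonneg.mpr hx.2
    have h0 := hx.1
    rw [norm_mul, norm_mul, norm_mul, norm_pow, norm_mul, Real.norm_of_nonneg (hc n),
      Real.norm_of_nonneg (rpow_nonneg h0.le _), Real.norm_of_nonneg (rpow_nonneg h1 _),
      Real.norm_eq_abs, Real.norm_of_nonneg h0.le]
    gcongr
    · exact hc n
    · exact mul_le_of_le_one_right (abs_nonneg z) hx.2
  · exact ae_of_all _ fun x _ ↦ hsum.summable.mul_left _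
  · simp only [tsum_mul_left, hsum.tsum_eq]
    exact hint.mul_const _
  · refine ae_of_all _ fun x hx ↦ ?_
    rw [uIoc_of_le zero_le_one] at hx
    refine (hasSum_one_sub_rpow_neg r ?_).mul_left _
    rw [abs_mul, abs_of_pos hx.1]
    exact (mul_le_of_le_one_right (abs_nonneg z) hx.2).trans_lt hz

end EulerIntegral

/-- The icosahedral integral as a value of the hypergeometric function. -/
lemma integral_icosahedral_eq_hyp2F1 {a : ℝ} (ha : 0 < a) (ha' : 1 - 11 * a - a ^ 2 = 0) :
    ∫ u in (0 : ℝ)..a, u ^ (-(5 : ℝ) / 6) * (1 - 11 * u - u ^ 2) ^ (-(1 : ℝ) / 6) =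
      2 * π * a ^ ((1 : ℝ) / 6) * hyp2F1 (1 / 6) (1 / 6) 1 (-a ^ 2) := by
  have hz : |-a ^ 2| < 1 := by
    rw [abs_neg, abs_of_pos (by positivity)]
    linarith
  have h := integral_eq_hyp2F1 (r := 1 / 6) (by norm_num) (by norm_num) hz
  rw [mul_one_div, sin_pi_div_six] at h
  have hsub := intervalIntegral.smul_integral_comp_mul_left (a := 0) (b := 1)
    (fun u : ℝ ↦ u ^ (-(5 : ℝ) / 6) * (1 - 11 * u - u ^ 2) ^ (-(1 : ℝ) / 6)) a
  rw [mul_zero, mul_one, smul_eq_mul] at hsub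
  rw [← hsub]
  trans a ^ ((1 : ℝ) / 6) * (π / (1 / 2) * hyp2F1 (1 / 6) (1 / 6) 1 (-a ^ 2))
  · rw [← h, ← intervalIntegral.integral_const_mul, ← intervalIntegral.integral_const_mul]
    refine intervalIntegral.integral_congr fun x hx ↦ ?_
    rw [Set.uIcc_of_le zero_le_one] at hx
    have hfactor : 1 - 11 * (a * x) - (a * x) ^ 2 = (1 - x) * (1 - -a ^ 2 * x) := by
      linear_combination x * ha'
    have hx0 : 0 ≤ 1 - -a ^ 2 * x := by nlinarith [mul_nonneg (sq_nonneg a) hx.1]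
    have hpow : a ^ ((1 : ℝ) / 6) = a * a ^ (-(5 : ℝ) / 6) := by
      rw [← rpow_one_add' ha.le (by norm_num)]
      norm_num
    rw [hfactor, mul_rpow (sub_nonneg.mpr hx.2) hx0, mul_rpow ha.le hx.1, hpow,
      show (1 : ℝ) / 6 - 1 = -5 / 6 by norm_num, ← neg_div]
    ring
  · ring

theorem integral_f4 :
    ∫ q in (0:ℝ)..1, eulerF q ^ 4 * q ^ (-(5 : ℝ) / 6) =
      π * (2 : ℝ) ^ ((1 : ℝ) / 6) * (Real.sqrt 5 - 1) ^ ((5 : ℝ) / 6) *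
        hyp2F1 (1 / 6) (1 / 6) 1 ((-123 + 55 * Real.sqrt 5) / 2) := by
  have hsq : √5 ^ 2 = 5 := sq_sqrt (by norm_num)
  have hpos : 0 < √5 - 1 := sub_pos.mpr (lt_sqrt_of_sq_lt (by norm_num))
  have hfive : ((√5 - 1) / 2) ^ 5 = (5 * √5 - 11) / 2 := by grind
  have hquad : 1 - 11 * ((√5 - 1) / 2) ^ 5 - (((√5 - 1) / 2) ^ 5) ^ 2 = 0 := by grind
  have harg : -(((√5 - 1) / 2) ^ 5) ^ 2 = (-123 + 55 * √5) / 2 := by grind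
  have hpow : 2 * (((√5 - 1) / 2) ^ 5) ^ ((1 : ℝ) / 6) =
      2 ^ ((1 : ℝ) / 6) * (√5 - 1) ^ ((5 : ℝ) / 6) := by
    rw [← rpow_natCast, ← rpow_mul (by positivity), div_rpow hpos.le zero_le_two,
      show (2 : ℝ) ^ ((1 : ℝ) / 6) = 2 / 2 ^ ((5 : ℝ) / 6) by
        rw [eq_div_iff (by positivity), ← rpow_add two_pos]
        norm_num]
    norm_num
    ring
  rw [integral_eulerF_pow_four, ← integral_icosahedral (by positivity) hquad,
    integral_icosahedral_eq_hyp2F1 (by positivity) hquad, harg, mul_right_comm 2, mul_comm _ π,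
    hpow, ← mul_assoc]
end
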